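/- arXiv:1408.3869 — 3 statements merged into one kernel-verified Lean document; each statement's English description precedes it below -/
import Mathlib

section
/- For every finite graph G, the treewidth of G is at most 105 times the separation number of G: tw(G) ≤ 105·sn(G). -/
open Finset

universe u

variable {V : Type u} [Fintype V] [DecidableEq V]

/-- `(A, B)` is a separation of the subgraph `H` of `G`: `A ∪ B` is the vertex set of `H`
and no edge of `H` has one end in `A \ B` and the other in `B \ A`.
Its order is `(A ∩ B).card`. -/
def SepOf {G : SimpleGraph V} (H : G.Subgraph) (A B : Finset V) : Prop :=
  (↑A ∪ ↑B : Set V) = H.verts ∧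
    ∀ u v : V, H.Adj u v → ¬(u ∈ A \ B ∧ v ∈ B \ A)

/-- `(A, B)` is a balanced separation of the subgraph `H`:
`|A \ B| ≤ (2/3) |V(H)|` and `|B \ A| ≤ (2/3) |V(H)|`. -/
def BalancedSepOf {G : SimpleGraph V} (H : G.Subgraph) (A B : Finset V) : Prop :=
  SepOf H A B ∧ 3 * (A \ B).card ≤ 2 * H.verts.ncard ∧ 3 * (B \ A).card ≤ 2 * H.verts.ncard

/-- The separation number of `G`: the smallest `s` such that every subgraph of `G`
has a balanced separation of order at most `s`. -/
noncomputable def sepNum (G : SimpleGraph V) : ℕ :=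
  sInf {s | ∀ H : G.Subgraph, ∃ A B : Finset V, BalancedSepOf H A B ∧ (A ∩ B).card ≤ s}

/-- `G` has a tree decomposition of width at most `w`: a tree `T` with bags
`β t ⊆ V(G)` covering all vertices and edges, such that for each vertex the set of
nodes whose bag contains it induces a connected subtree, with all bags of size at
most `w + 1`. -/
def HasTDWidthLE (G : SimpleGraph V) (w : ℕ) : Prop :=
  ∃ (ι : Type u) (T : SimpleGraph ι) (β : ι → Finset V),
    T.IsTree ∧
    (∀ v : V, ∃ t, v ∈ β t) ∧
    (∀ u v : V, G.Adj u v → ∃ t, u ∈ β t ∧ v ∈ β t) ∧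
    (∀ v : V, (T.induce {t | v ∈ β t}).Connected) ∧
    (∀ t, (β t).card ≤ w + 1)

/-- The treewidth of `G`: the minimum width of a tree decomposition of `G`. -/
noncomputable def treewidth (G : SimpleGraph V) : ℕ :=
  sInf {w | HasTDWidthLE G w}

set_option linter.unusedSectionVars false

/-- The tree obtained from `T` by attaching a new leaf `none` to the node `t`. -/
def addLeaf {ι : Type*} (T : SimpleGraph ι) (t : ι) : SimpleGraph (Option ι) :=
  T.map Function.Embedding.some ⊔ SimpleGraph.edge none (some t)

theorem addLeaf_adj_some {ι : Type*} {T : SimpleGraph ι} {t a b : ι} (h : T.Adj a b) :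
    (addLeaf T t).Adj (some a) (some b) :=
  Or.inl ((SimpleGraph.map_adj _ _ _ _).2 ⟨a, b, h, rfl, rfl⟩)

theorem addLeaf_adj_none {ι : Type*} (T : SimpleGraph ι) (t : ι) :
    (addLeaf T t).Adj (some t) none :=
  Or.inr ((SimpleGraph.edge_adj ..).2 ⟨Or.inr ⟨rfl, rfl⟩, by simp⟩)

theorem connected_induce_image_addLeaf {ι : Type*} {T : SimpleGraph ι} (t : ι) {s : Set ι}
    (hs : (T.induce s).Connected) : ((addLeaf T t).induce (some '' s)).Connected := by
  let f : T.induce s →g (addLeaf T t).induce (some '' s) :=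
    { toFun := fun x => ⟨some x.1, x.1, x.2, rfl⟩
      map_rel' := fun h => addLeaf_adj_some h }
  refine @SimpleGraph.Connected.mk _ _ (hs.preconnected.map f ?_) ?_
  · rintro ⟨_, x, hx, rfl⟩
    exact ⟨⟨x, hx⟩, rfl⟩
  · exact hs.nonempty.map f

theorem connected_induce_insert_addLeaf {ι : Type*} {T : SimpleGraph ι} {t : ι} {s : Set ι}
    (hs : (T.induce s).Connected) (ht : t ∈ s) :
    ((addLeaf T t).induce (some '' s ∪ {none})).Connected :=
  SimpleGraph.connected_induce_union (connected_induce_image_addLeaf t hs).preconnected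
    SimpleGraph.Preconnected.of_subsingleton ⟨t, ht, rfl⟩ rfl (addLeaf_adj_none T t)

theorem isTree_addLeaf {ι : Type*} [Finite ι] {T : SimpleGraph ι} (hT : T.IsTree) (t : ι) :
    (addLeaf T t).IsTree := by
  classical
  have := Fintype.ofFinite ι
  refine SimpleGraph.isTree_iff_connected_and_card.2 ⟨?_, ?_⟩
  · have hu : ((addLeaf T t).induce (some '' Set.univ ∪ {none})).Connected :=
      connected_induce_insert_addLeaf
        ((SimpleGraph.induceUnivIso T).connected_iff.2 hT.connected) (Set.mem_univ t)
    have he : (some '' Set.univ ∪ {none} : Set (Option ι)) = Set.univ := by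
      ext x
      cases x <;> simp
    rw [he] at hu
    exact (SimpleGraph.induceUnivIso _).connected_iff.1 hu
  · have h := hT.card_edgeFinset
    have hn : ¬ (T.map Function.Embedding.some).Adj none (some t) := by
      rintro ⟨-, a, b, -, ha, -⟩
      cases ha
    have h1 := SimpleGraph.card_edgeFinset_sup_edge (G := T.map Function.Embedding.some)
      hn (by simp)
    rw [SimpleGraph.card_edgeFinset_map] at h1
    rw [Nat.card_eq_fintype_card, Nat.card_eq_fintype_card, ← SimpleGraph.edgeFinset_card,
      Fintype.card_option, ← h, ← h1]
    congr 2
    ext e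
    rw [SimpleGraph.mem_edgeFinset, SimpleGraph.mem_edgeFinset, addLeaf]

open Classical in
/-- The vertices of `Y` outside `C` that have a neighbour in `C`. -/
noncomputable def outerBoundary (G : SimpleGraph V) (Y C : Finset V) : Finset V :=
  Y.filter fun v => v ∉ C ∧ ∃ u ∈ C, G.Adj u v

/-- `D` induces a connected subgraph: no proper nonempty subset of `D` is closed under
adjacency in `D`. -/
def IsConnSet (G : SimpleGraph V) (D : Finset V) : Prop :=
  ∀ U ⊆ D, U.Nonempty → (∀ u ∈ U, ∀ v ∈ D, G.Adj u v → v ∈ U) → U = D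

theorem mem_outerBoundary {G : SimpleGraph V} {Y C : Finset V} {v : V} :
    v ∈ outerBoundary G Y C ↔ v ∈ Y ∧ v ∉ C ∧ ∃ u ∈ C, G.Adj u v := by
  simp [outerBoundary]

theorem card_outerBoundary_inter_add_union_le (G : SimpleGraph V) (Y C₁ C₂ : Finset V) :
    (outerBoundary G Y (C₁ ∩ C₂)).card + (outerBoundary G Y (C₁ ∪ C₂)).card ≤
      (outerBoundary G Y C₁).card + (outerBoundary G Y C₂).card := by
  rw [← card_union_add_card_inter, ← card_union_add_card_inter (outerBoundary G Y C₁)]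
  refine Nat.add_le_add (card_le_card fun v => ?_) (card_le_card fun v => ?_) <;>
  · simp only [mem_union, mem_inter, mem_outerBoundary]
    grind

theorem IsConnSet.subset_of_disjoint_outerBoundary {G : SimpleGraph V} {Y C D : Finset V}
    (hD : IsConnSet G D) (hDY : D ⊆ Y) (hdisj : Disjoint D (outerBoundary G Y C))
    (hne : (D ∩ C).Nonempty) : D ⊆ C := by
  have h : D ∩ C = D := by
    refine hD _ inter_subset_left hne fun u hu v hv huv => ?_
    by_contra hvC
    exact disjoint_left.1 hdisj hv (mem_outerBoundary.2
      ⟨hDY hv, fun h => hvC (mem_inter.2 ⟨hv, h⟩), u, (mem_inter.1 hu).2, huv⟩)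
  exact inter_eq_left.1 h

theorem IsConnSet.union_of_subset_outerBoundary {G : SimpleGraph V} {Y D N : Finset V}
    (hD : IsConnSet G D) (hN : N ⊆ outerBoundary G Y D) : IsConnSet G (D ∪ N) := by
  intro U hU hUne hcl
  have hne : (D ∩ U).Nonempty := by
    obtain ⟨x, hx⟩ := hUne
    rcases mem_union.1 (hU hx) with hxD | hxN
    · exact ⟨x, mem_inter.2 ⟨hxD, hx⟩⟩
    · obtain ⟨-, -, u, hu, hux⟩ := mem_outerBoundary.1 (hN hxN)
      exact ⟨u, mem_inter.2 ⟨hu, hcl x hx u (mem_union_left _ hu) hux.symm⟩⟩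
  have hDU : D ⊆ U := inter_eq_left.1 <| hD _ inter_subset_left hne fun u hu v hv huv =>
    mem_inter.2 ⟨hv, hcl u (mem_inter.1 hu).2 v (mem_union_left _ hv) huv⟩
  refine Subset.antisymm hU (union_subset hDU fun x hx => ?_)
  obtain ⟨-, -, u, hu, hux⟩ := mem_outerBoundary.1 (hN hx)
  exact hcl u (hDU hu) x (mem_union_right _ hx) hux

theorem exists_component (G : SimpleGraph V) {Z : Finset V} (hZ : Z.Nonempty) :
    ∃ D ⊆ Z, D.Nonempty ∧ IsConnSet G D ∧ Disjoint Z (outerBoundary G univ D) := by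
  obtain ⟨D, hD⟩ := Set.Finite.exists_minimal
    (s := {D : Finset V | D ⊆ Z ∧ D.Nonempty ∧ Disjoint Z (outerBoundary G univ D)})
    (Set.toFinite _) ⟨Z, Subset.rfl, hZ, disjoint_left.2 fun v hv h =>
      (mem_outerBoundary.1 h).2.1 hv⟩
  obtain ⟨hDZ, hDne, hDb⟩ := hD.prop
  refine ⟨D, hDZ, hDne, fun U hU hUne hcl => ?_, hDb⟩
  refine Subset.antisymm hU (hD.le_of_le ⟨hU.trans hDZ, hUne, ?_⟩ hU)
  refine disjoint_left.2 fun v hv h => ?_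
  obtain ⟨-, hvU, u, hu, huv⟩ := mem_outerBoundary.1 h
  by_cases hvD : v ∈ D
  · exact hvU (hcl u hu v hvD huv)
  · exact disjoint_left.1 hDb hv (mem_outerBoundary.2 ⟨mem_univ _, hvD, u, hU hu, huv⟩)

/-- There is a tree decomposition of `G[Y]` of width at most `w` such that every connected
component of `G - Y` has at most `m` neighbours, all of which lie in one bag. -/
def HasPartialTD (G : SimpleGraph V) (w m : ℕ) (Y : Finset V) : Prop :=
  ∃ (ι : Type u) (_ : Finite ι) (T : SimpleGraph ι) (β : ι → Finset V),
    T.IsTree ∧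
    (∀ t, β t ⊆ Y) ∧
    (∀ v ∈ Y, (T.induce {t | v ∈ β t}).Connected) ∧
    (∀ u ∈ Y, ∀ v ∈ Y, G.Adj u v → ∃ t, u ∈ β t ∧ v ∈ β t) ∧
    (∀ t, (β t).card ≤ w + 1) ∧
    ∀ D, D.Nonempty → IsConnSet G D → Disjoint D Y → outerBoundary G univ D ⊆ Y →
      (outerBoundary G univ D).card ≤ m ∧ ∃ t, outerBoundary G univ D ⊆ β t

theorem hasPartialTD_empty (G : SimpleGraph V) (w m : ℕ) : HasPartialTD G w m ∅ := by
  refine ⟨PUnit, inferInstance, ⊥, fun _ => ∅, SimpleGraph.IsTree.of_subsingleton, by simp,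
    by simp, by simp, by simp, fun D _ _ _ h => ?_⟩
  rw [subset_empty.1 h]
  simp

theorem HasPartialTD.hasTDWidthLE {G : SimpleGraph V} {w m : ℕ}
    (h : HasPartialTD G w m univ) : HasTDWidthLE G w := by
  obtain ⟨ι, -, T, β, hT, -, hconn, hadj, hcard, -⟩ := h
  refine ⟨ι, T, β, hT, fun v => ?_, fun u v => hadj u (mem_univ _) v (mem_univ _),
    fun v => hconn v (mem_univ _), hcard⟩
  obtain ⟨t, ht⟩ := (hconn v (mem_univ _)).nonempty
  exact ⟨t, ht⟩

/-- A tree decomposition of `G[Y]` extends by the new bag `K` to one of `G[Y ∪ K]`. -/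
theorem HasPartialTD.extend {G : SimpleGraph V} {k : ℕ}
    (hG : ∀ W : Finset V, W.card ≤ 2 * k + 1 → ∃ S : Finset V, S.card ≤ k ∧
      ∀ D, IsConnSet G D → Disjoint D S → (D ∩ W).card ≤ k)
    {Y : Finset V} (hY : HasPartialTD G (3 * k) (2 * k) Y) (hYu : Y ≠ univ) :
    ∃ Y', Y ⊂ Y' ∧ HasPartialTD G (3 * k) (2 * k) Y' := by
  obtain ⟨ι, _, T, β, hT, hsub, hconn, hadj, hcard, hcomp⟩ := hY
  obtain ⟨D, hDY, ⟨v, hv⟩, hD, hDb⟩ := exists_component G (Z := Yᶜ)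
    (nonempty_iff_ne_empty.2 fun h => hYu (by simpa using h))
  have hN : ∀ x, x ∈ outerBoundary G univ D → x ∈ Y := fun x hx => by
    by_contra h
    exact disjoint_left.1 hDb (mem_compl.2 h) hx
  have hDY' : Disjoint D Y := disjoint_left.2 fun x hx => mem_compl.1 (hDY hx)
  obtain ⟨hNcard, t, ht⟩ := hcomp D ⟨v, hv⟩ hD hDY' hN
  set N := outerBoundary G univ D with hNdef
  obtain ⟨S, hS, hSW⟩ := hG (insert v N) ((card_insert_le _ _).trans (by omega))
  set K := insert v N ∪ S ∩ D with hKdef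
  have hK : ∀ x, x ∈ K → x ∈ D ∨ x ∈ N := by
    intro x hx
    simp only [hKdef, mem_union, mem_insert, mem_inter] at hx
    grind
  have hNK : N ⊆ K := (subset_insert _ _).trans subset_union_left
  have hvK : v ∈ K := mem_union_left _ (mem_insert_self _ _)
  have hnbr : ∀ x ∈ D, ∀ y ∈ Y ∪ K, G.Adj x y → y ∈ K := by
    intro x hx y hy hxy
    rcases mem_union.1 hy with hy | hy
    · exact hNK (mem_outerBoundary.2
        ⟨mem_univ _, fun h => disjoint_left.1 hDY' h hy, x, hx, hxy⟩)
    · exact hy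
  refine ⟨Y ∪ K, ⟨subset_union_left, fun h =>
    disjoint_left.1 hDY' hv (h (mem_union_right _ hvK))⟩, Option ι, inferInstance, addLeaf T t,
    fun o => o.elim K β, isTree_addLeaf hT t, ?_, ?_, ?_, ?_, ?_⟩
  · rintro (_ | s)
    · exact subset_union_right
    · exact (hsub s).trans subset_union_left
  · intro x hx
    by_cases hxY : x ∈ Y
    · by_cases hxK : x ∈ K
      · have hxN : x ∈ N := (hK x hxK).resolve_left fun h => disjoint_left.1 hDY' h hxY
        have he : {o : Option ι | x ∈ o.elim K β} = some '' {s | x ∈ β s} ∪ {none} := by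
          ext (_ | s) <;> simp [hxK]
        rw [he]
        exact connected_induce_insert_addLeaf (hconn x hxY) (ht hxN)
      · have he : {o : Option ι | x ∈ o.elim K β} = some '' {s | x ∈ β s} := by
          ext (_ | s) <;> simp [hxK]
        rw [he]
        exact connected_induce_image_addLeaf t (hconn x hxY)
    · have hxK : x ∈ K := (mem_union.1 hx).resolve_left hxY
      have he : {o : Option ι | x ∈ o.elim K β} = {none} := by
        ext (_ | s)
        · simp [hxK]
        · simpa using fun h => hxY (hsub s h)
      rw [he]
      exact @SimpleGraph.Connected.mk _ _ SimpleGraph.Preconnected.of_subsingleton ⟨none, rfl⟩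
  · intro x hx y hy hxy
    by_cases hxD : x ∈ D
    · exact ⟨none, (mem_union.1 hx).resolve_left (disjoint_left.1 hDY' hxD),
        hnbr x hxD y hy hxy⟩
    by_cases hyD : y ∈ D
    · exact ⟨none, hnbr y hyD x hx hxy.symm,
        (mem_union.1 hy).resolve_left (disjoint_left.1 hDY' hyD)⟩
    have hYof : ∀ z ∈ Y ∪ K, z ∉ D → z ∈ Y := fun z hz hzD =>
      (mem_union.1 hz).elim id fun h => hN z ((hK z h).resolve_left hzD)
    obtain ⟨s, hs⟩ := hadj x (hYof x hx hxD) y (hYof y hy hyD) hxy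
    exact ⟨some s, hs⟩
  · rintro (_ | s)
    · have h1 : (S ∩ D).card ≤ k := (card_le_card inter_subset_left).trans hS
      have h2 := card_insert_le v N
      have h3 : K.card ≤ _ := card_union_le (insert v N) (S ∩ D)
      change K.card ≤ _
      omega
    · exact hcard s
  · intro D' hD'ne hD' hD'Y hD'b
    have hdY : Disjoint D' Y := hD'Y.mono_right subset_union_left
    have hdK : Disjoint D' K := hD'Y.mono_right subset_union_right
    by_cases hDD : (D' ∩ D).Nonempty
    · have hsubD : D' ⊆ D := hD'.subset_of_disjoint_outerBoundary (subset_univ _)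
        (hdY.mono_right hN) hDD
      have hbK : outerBoundary G univ D' ⊆ K := fun x hx => by
        obtain ⟨-, -, u, hu, hux⟩ := mem_outerBoundary.1 hx
        exact hnbr u (hsubD hu) x (hD'b hx) hux
      refine ⟨?_, none, hbK⟩
      have hconn' := hD'.union_of_subset_outerBoundary
        (sdiff_subset : outerBoundary G univ D' \ S ⊆ outerBoundary G univ D')
      have hdS : Disjoint (D' ∪ outerBoundary G univ D' \ S) S := by
        refine disjoint_union_left.2 ⟨disjoint_left.2 fun x hx hxS => ?_, sdiff_disjoint⟩
        exact disjoint_left.1 hdK hx (mem_union_right _ (mem_inter.2 ⟨hxS, hsubD hx⟩))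
      have h1 := hSW _ hconn' hdS
      have h2 : outerBoundary G univ D' \ S ⊆
          (D' ∪ outerBoundary G univ D' \ S) ∩ insert v N := by
        intro x hx
        refine mem_inter.2 ⟨mem_union_right _ hx, ?_⟩
        have hx' := mem_sdiff.1 hx
        exact (mem_union.1 (hbK hx'.1)).resolve_right fun h => hx'.2 (mem_inter.1 h).1
      have h3 := card_le_card h2
      have h4 := card_le_card_sdiff_add_card (s := outerBoundary G univ D') (t := S)
      omega
    · have hbY : outerBoundary G univ D' ⊆ Y := fun x hx => by
        refine (mem_union.1 (hD'b hx)).elim id fun hxK => (hK x hxK).elim (fun hxD => ?_) (hN x)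
        exfalso
        obtain ⟨-, hxD', u, hu, hux⟩ := mem_outerBoundary.1 hx
        have huN : u ∈ N := mem_outerBoundary.2
          ⟨mem_univ _, fun h => hDD ⟨u, mem_inter.2 ⟨hu, h⟩⟩, x, hxD, hux.symm⟩
        exact disjoint_left.1 hdY hu (hN u huN)
      obtain ⟨h1, s, hs⟩ := hcomp D' hD'ne hD' hdY hbY
      exact ⟨h1, some s, hs⟩

theorem hasTDWidthLE_of_forall_exists_separator {G : SimpleGraph V} {k : ℕ}
    (hG : ∀ W : Finset V, W.card ≤ 2 * k + 1 → ∃ S : Finset V, S.card ≤ k ∧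
      ∀ D, IsConnSet G D → Disjoint D S → (D ∩ W).card ≤ k) :
    HasTDWidthLE G (3 * k) := by
  obtain ⟨Y, hY⟩ := Set.Finite.exists_maximal
    (s := {Y | HasPartialTD G (3 * k) (2 * k) Y}) (Set.toFinite _) ⟨∅, hasPartialTD_empty G _ _⟩
  by_cases hYu : Y = univ
  · exact (hYu ▸ hY.prop : HasPartialTD G (3 * k) (2 * k) univ).hasTDWidthLE
  · obtain ⟨Y', hlt, hY'⟩ := HasPartialTD.extend hG hY.prop hYu
    exact absurd (hY.le_of_ge hY' hlt.subset) hlt.not_subset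

/-- `D` induces a connected subgraph and contains more than `k` vertices of `W`. If `W` has at
most `2 * k + 1` vertices, this is a majority of them. -/
def IsBig (G : SimpleGraph V) (W : Finset V) (k : ℕ) (D : Finset V) : Prop :=
  IsConnSet G D ∧ k < (D ∩ W).card

/-- `C` contains a connected set with more than `k` vertices of `W`. -/
def Hosts (G : SimpleGraph V) (W : Finset V) (k : ℕ) (C : Finset V) : Prop :=
  ∃ D ⊆ C, IsBig G W k D

/-- `G[Y]` still contains a connected set with more than `k` vertices of `W` after the removal
of any `j` vertices. -/
def IsRobust (G : SimpleGraph V) (W : Finset V) (k j : ℕ) (Y : Finset V) : Prop :=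
  ∀ S : Finset V, S.card ≤ j → Hosts G W k (Y \ S)

/-- The smallest number of vertices of an `IsRobust` set of order `j`. -/
noncomputable def minRobustCard (G : SimpleGraph V) (W : Finset V) (k j : ℕ) : ℕ :=
  sInf {n | ∃ Y, IsRobust G W k j Y ∧ Y.card = n}

theorem Hosts.mono {G : SimpleGraph V} {W C C' : Finset V} {k : ℕ} (h : Hosts G W k C)
    (hC : C ⊆ C') : Hosts G W k C' :=
  let ⟨D, hDC, hD⟩ := h
  ⟨D, hDC.trans hC, hD⟩

theorem IsRobust.mono {G : SimpleGraph V} {W Y Y' : Finset V} {k i j : ℕ}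
    (h : IsRobust G W k j Y) (hij : i ≤ j) (hY : Y ⊆ Y') : IsRobust G W k i Y' :=
  fun S hS => (h S (hS.trans hij)).mono (sdiff_subset_sdiff hY Subset.rfl)

theorem IsRobust.hosts {G : SimpleGraph V} {W Y : Finset V} {k j : ℕ}
    (h : IsRobust G W k j Y) : Hosts G W k Y :=
  (h ∅ (by simp)).mono sdiff_subset

theorem Hosts.lt_card {G : SimpleGraph V} {W C : Finset V} {k : ℕ} (h : Hosts G W k C) :
    k < C.card :=
  let ⟨_, hDC, hD⟩ := h
  hD.2.trans_le (card_le_card (inter_subset_left.trans hDC))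

theorem IsBig.inter_nonempty {G : SimpleGraph V} {W D D' : Finset V} {k : ℕ}
    (hW : W.card ≤ 2 * k + 1) (hD : IsBig G W k D) (hD' : IsBig G W k D') :
    (D ∩ D').Nonempty := by
  by_contra h
  have hdisj : Disjoint (D ∩ W) (D' ∩ W) :=
    (disjoint_iff_inter_eq_empty.2 (not_nonempty_iff_eq_empty.1 h)).mono
      inter_subset_left inter_subset_left
  have h1 := card_union_of_disjoint hdisj
  have h2 : (D ∩ W ∪ D' ∩ W).card ≤ W.card :=
    card_le_card (union_subset inter_subset_right inter_subset_right)
  have h3 := hD.2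
  have h4 := hD'.2
  omega

theorem IsBig.subset_of_hosts {G : SimpleGraph V} {W Y C D S : Finset V} {k : ℕ}
    (hW : W.card ≤ 2 * k + 1) (hD : IsBig G W k D) (hDY : D ⊆ Y \ S) (hC : Hosts G W k C)
    (hS : outerBoundary G Y C ⊆ S) : D ⊆ C := by
  obtain ⟨D', hD'C, hD'⟩ := hC
  refine hD.1.subset_of_disjoint_outerBoundary (hDY.trans sdiff_subset)
    (disjoint_left.2 fun x hx hxb => (mem_sdiff.1 (hDY hx)).2 (hS hxb)) ?_
  exact (hD.inter_nonempty hW hD').mono (inter_subset_inter Subset.rfl hD'C)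

theorem IsRobust.of_card_outerBoundary_le {G : SimpleGraph V} {W Y C : Finset V} {k s j : ℕ}
    (hW : W.card ≤ 2 * k + 1) (hY : IsRobust G W k (j + s) Y) (hC : Hosts G W k C)
    (hs : (outerBoundary G Y C).card ≤ s) : IsRobust G W k j C := by
  intro S hS
  obtain ⟨D, hDY, hD⟩ := hY (S ∪ outerBoundary G Y C) ((card_union_le _ _).trans (by omega))
  have hDC := hD.subset_of_hosts hW hDY hC subset_union_right
  exact ⟨D, fun x hx => mem_sdiff.2 ⟨hDC hx, fun h =>
    (mem_sdiff.1 (hDY hx)).2 (mem_union_left _ h)⟩, hD⟩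

theorem minRobustCard_le {G : SimpleGraph V} {W Y : Finset V} {k j : ℕ}
    (hY : IsRobust G W k j Y) : minRobustCard G W k j ≤ Y.card :=
  Nat.sInf_le ⟨Y, hY, rfl⟩

theorem exists_card_eq_minRobustCard {G : SimpleGraph V} {W : Finset V} {k j : ℕ}
    (h : IsRobust G W k j univ) :
    ∃ Y, IsRobust G W k j Y ∧ Y.card = minRobustCard G W k j :=
  Nat.sInf_mem (s := {n | ∃ Y, IsRobust G W k j Y ∧ Y.card = n}) ⟨_, univ, h, rfl⟩

theorem minRobustCard_mono {G : SimpleGraph V} {W : Finset V} {k i j : ℕ}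
    (h : IsRobust G W k j univ) (hij : i ≤ j) :
    minRobustCard G W k i ≤ minRobustCard G W k j := by
  obtain ⟨Y, hY, hYc⟩ := exists_card_eq_minRobustCard h
  exact hYc ▸ minRobustCard_le (hY.mono hij Subset.rfl)

/-- Every induced subgraph has a balanced separation of order at most `a`. -/
def HasBalancedSeps (G : SimpleGraph V) (a : ℕ) : Prop :=
  ∀ Y : Finset V, ∃ A B : Finset V, A ∪ B = Y ∧
    (∀ u ∈ A \ B, ∀ v ∈ B \ A, ¬ G.Adj u v) ∧
    3 * (A \ B).card ≤ 2 * Y.card ∧ 3 * (B \ A).card ≤ 2 * Y.card ∧ (A ∩ B).card ≤ a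

theorem hasBalancedSeps_sepNum (G : SimpleGraph V) : HasBalancedSeps G (sepNum G) := by
  have hmem : sepNum G ∈
      {s | ∀ H : G.Subgraph, ∃ A B : Finset V, BalancedSepOf H A B ∧ (A ∩ B).card ≤ s} := by
    refine Nat.sInf_mem ⟨Fintype.card V, fun H => ?_⟩
    have hH : H.verts.Finite := Set.toFinite _
    exact ⟨hH.toFinset, hH.toFinset, ⟨⟨by simp, by simp⟩, by simp, by simp⟩, card_le_univ _⟩
  intro Y
  obtain ⟨A, B, ⟨⟨hAB, hadj⟩, hA, hB⟩, hcard⟩ := hmem ((⊤ : G.Subgraph).induce Y)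
  simp only [SimpleGraph.Subgraph.induce_verts, Set.ncard_coe_finset] at hAB hA hB
  have hY : A ∪ B = Y := by exact_mod_cast hAB
  refine ⟨A, B, hY, fun u hu v hv huv => hadj u v ?_ ⟨hu, hv⟩, hA, hB, hcard⟩
  simp only [SimpleGraph.Subgraph.induce_adj, SimpleGraph.Subgraph.top_adj, ← hY]
  exact ⟨mem_union_left _ (mem_sdiff.1 hu).1, mem_union_right _ (mem_sdiff.1 hv).1, huv⟩

theorem HasBalancedSeps.pos [Nonempty V] {G : SimpleGraph V} {a : ℕ}
    (h : HasBalancedSeps G a) : 0 < a := by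
  obtain ⟨v⟩ := ‹Nonempty V›
  obtain ⟨A, B, hAB, -, hA, hB, hcard⟩ := h {v}
  have h1 := card_sdiff_add_card_inter A B
  have h2 := card_union_add_card_inter A B
  have h3 := card_sdiff_add_card_inter B A
  rw [inter_comm] at h3
  rw [hAB] at h2
  rw [card_singleton] at h2 hA hB
  omega

theorem IsRobust.exists_hosts_card_le {G : SimpleGraph V} {W Y : Finset V} {k j a : ℕ}
    (hG : HasBalancedSeps G a) (hY : IsRobust G W k j Y) (haj : a ≤ j) :
    ∃ C ⊆ Y, Hosts G W k C ∧ (outerBoundary G Y C).card ≤ a ∧ 3 * C.card ≤ 2 * Y.card := by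
  obtain ⟨A, B, rfl, hadj, hA, hB, hcard⟩ := hG Y
  obtain ⟨D, hDY, hD, hDW⟩ := hY (A ∩ B) (hcard.trans haj)
  have hbA : outerBoundary G (A ∪ B) (A \ B) ⊆ A ∩ B := by
    intro x hx
    obtain ⟨hxY, hxA, u, hu, hux⟩ := mem_outerBoundary.1 hx
    have := hadj u hu x
    grind
  have hbB : outerBoundary G (A ∪ B) (B \ A) ⊆ A ∩ B := by
    intro x hx
    obtain ⟨hxY, hxA, u, hu, hux⟩ := mem_outerBoundary.1 hx
    have := fun h => hadj x h u hu hux.symm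
    grind
  have hdisj : Disjoint D (A ∩ B) := disjoint_left.2 fun x hx => (mem_sdiff.1 (hDY hx)).2
  have hDsub := hDY.trans sdiff_subset
  by_cases h : (D ∩ (A \ B)).Nonempty
  · exact ⟨A \ B, sdiff_subset.trans subset_union_left,
      ⟨D, hD.subset_of_disjoint_outerBoundary hDsub (hdisj.mono_right hbA) h, hD, hDW⟩,
      (card_le_card hbA).trans hcard, hA⟩
  · refine ⟨B \ A, sdiff_subset.trans subset_union_right, ⟨D, fun x hx => ?_, hD, hDW⟩,
      (card_le_card hbB).trans hcard, hB⟩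
    have h1 := hDY hx
    have h2 : x ∉ A \ B := fun hxA => h ⟨x, mem_inter.2 ⟨hx, hxA⟩⟩
    grind

theorem minRobustCard_growth {G : SimpleGraph V} {W : Finset V} {k j a : ℕ}
    (hW : W.card ≤ 2 * k + 1) (hG : HasBalancedSeps G a) (hj : IsRobust G W k (j + a) univ) :
    3 * minRobustCard G W k j ≤ 2 * minRobustCard G W k (j + a) := by
  obtain ⟨Y, hY, hYc⟩ := exists_card_eq_minRobustCard hj
  obtain ⟨C, -, hC, hbC, hCc⟩ := hY.exists_hosts_card_le hG (Nat.le_add_left a j)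
  have := minRobustCard_le (hY.of_card_outerBoundary_le hW hC hbC)
  omega

theorem minRobustCard_linear_growth {G : SimpleGraph V} {W : Finset V} {k j a : ℕ}
    (hW : W.card ≤ 2 * k + 1) (hG : HasBalancedSeps G a) (r : ℕ)
    (hj : IsRobust G W k (j + r * a) univ) :
    (r + 2) * minRobustCard G W k j ≤ 2 * minRobustCard G W k (j + r * a) := by
  induction r with
  | zero => simp
  | succ r ih =>
    have he : j + (r + 1) * a = j + r * a + a := by ring
    rw [he] at hj ⊢
    have hj' := hj.mono (Nat.le_add_right _ a) Subset.rfl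
    have h1 := ih hj'
    have h2 := minRobustCard_growth hW hG hj
    have h3 := minRobustCard_mono hj' (Nat.le_add_right j (r * a))
    linarith

/-- `X` is spread out over `G[Y ∪ X]`: every set that hosts a majority of `W` and has boundary
of size `s` misses at most `L * s` vertices of `X`. -/
def IsSpread (G : SimpleGraph V) (W : Finset V) (k L : ℕ) (Y X : Finset V) : Prop :=
  ∀ C ⊆ Y ∪ X, Hosts G W k C → (X \ C).card ≤ L * (outerBoundary G (Y ∪ X) C).card

/-- A set attaining equality in the definition of `IsSpread`. -/
def IsTight (G : SimpleGraph V) (W : Finset V) (k L : ℕ) (Y X C : Finset V) : Prop :=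
  C ⊆ Y ∪ X ∧ Hosts G W k C ∧ (X \ C).card = L * (outerBoundary G (Y ∪ X) C).card

theorem IsTight.inter {G : SimpleGraph V} {W Y X C₁ C₂ : Finset V} {k c L : ℕ}
    (hW : W.card ≤ 2 * k + 1) (hY : IsRobust G W k (2 * c) Y) (hX : IsSpread G W k L Y X)
    (hXc : X.card < c * L) (h₁ : IsTight G W k L Y X C₁) (h₂ : IsTight G W k L Y X C₂) :
    IsTight G W k L Y X (C₁ ∩ C₂) := by
  obtain ⟨hs₁, hh₁, ht₁⟩ := h₁
  obtain ⟨hs₂, hh₂, ht₂⟩ := h₂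
  have hbound : ∀ C : Finset V, (X \ C).card = L * (outerBoundary G (Y ∪ X) C).card →
      (outerBoundary G (Y ∪ X) C).card ≤ c := by
    intro C hC
    have h1 : (X \ C).card ≤ X.card := card_le_card sdiff_subset
    by_contra! h2
    have h3 := Nat.mul_le_mul_left L h2.le
    rw [mul_comm c L] at hXc
    omega
  have hb₁ := hbound C₁ ht₁
  have hb₂ := hbound C₂ ht₂
  have hhost : Hosts G W k (C₁ ∩ C₂) := by
    obtain ⟨D, hDY, hD⟩ := (hY.mono le_rfl (subset_union_left (s₂ := X)))
      (outerBoundary G (Y ∪ X) C₁ ∪ outerBoundary G (Y ∪ X) C₂)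
      ((card_union_le _ _).trans (by omega))
    exact ⟨D, subset_inter (hD.subset_of_hosts hW hDY hh₁ subset_union_left)
      (hD.subset_of_hosts hW hDY hh₂ subset_union_right), hD⟩
  have hi := hX _ (inter_subset_left.trans hs₁) hhost
  have hu := hX _ (union_subset hs₁ hs₂) (hh₁.mono subset_union_left)
  have hsub := Nat.mul_le_mul_left L
    (card_outerBoundary_inter_add_union_le G (Y ∪ X) C₁ C₂)
  have hmod : (X \ (C₁ ∩ C₂)).card + (X \ (C₁ ∪ C₂)).card = (X \ C₁).card + (X \ C₂).card := by
    rw [← card_union_add_card_inter (X \ C₁), Finset.sdiff_inter_distrib_right,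
      Finset.sdiff_union_distrib]
  refine ⟨inter_subset_left.trans hs₁, hhost, le_antisymm hi ?_⟩
  rw [mul_add, mul_add] at hsub
  omega

theorem exists_isTight_of_not_isSpread_insert {G : SimpleGraph V} {W Y X : Finset V} {x : V}
    {k c L : ℕ} (hW : W.card ≤ 2 * k + 1) (hY : IsRobust G W k c Y) (hL : 0 < L)
    (hX : IsSpread G W k L Y X) (hXc : X.card < c * L) (hxX : x ∉ X)
    (hx : ¬ IsSpread G W k L Y (insert x X)) :
    ∃ C, IsTight G W k L Y X C ∧ x ∉ C ∧ (x ∉ Y → ∀ u ∈ C, ¬ G.Adj u x) := by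
  simp only [IsSpread, not_forall, not_le] at hx
  obtain ⟨C, hCs, hC, hlt⟩ := hx
  have hCY : x ∈ C → x ∉ Y ∪ X := by
    intro hxC hxY
    have hYe : Y ∪ insert x X = Y ∪ X := by
      rw [union_insert, insert_eq_of_mem hxY]
    have := hX C (hYe ▸ hCs) hC
    rw [hYe, insert_sdiff_of_mem _ hxC] at hlt
    omega
  have hb : outerBoundary G (Y ∪ X) (C.erase x) ⊆ outerBoundary G (Y ∪ insert x X) C := by
    intro v hv
    obtain ⟨hvY, hvC, u, hu, huv⟩ := mem_outerBoundary.1 hv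
    refine mem_outerBoundary.2 ⟨union_subset_union_right (subset_insert x X) hvY,
      fun h => hvC (mem_erase.2 ⟨?_, h⟩), u, mem_of_mem_erase hu, huv⟩
    rintro rfl
    exact hCY h hvY
  have hsubE : C.erase x ⊆ Y ∪ X := fun v hv => by
    have := hCs (mem_of_mem_erase hv)
    have := ne_of_mem_erase hv
    simp only [mem_union, mem_insert] at *
    tauto
  have hbL := Nat.mul_le_mul_left L (card_le_card hb)
  have hxC : x ∉ C := by
    intro hxC
    have he : insert x X \ C = X \ C.erase x := by
      ext v
      simp only [mem_sdiff, mem_insert, mem_erase]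
      grind
    rw [he] at hlt
    have hXle : (X \ C.erase x).card ≤ X.card := card_le_card sdiff_subset
    have hbc : (outerBoundary G (Y ∪ X) (C.erase x)).card ≤ c := by
      by_contra! h
      have := Nat.mul_le_mul_left L h.le
      rw [mul_comm c L] at hXc
      omega
    obtain ⟨D, hDY, hD⟩ := hY _ hbc
    have hDX : D ⊆ Y ∪ X := (hDY.trans sdiff_subset).trans subset_union_left
    have hhost : Hosts G W k (C.erase x) := by
      refine ⟨D, hD.1.subset_of_disjoint_outerBoundary hDX
        (disjoint_left.2 fun v hv => (mem_sdiff.1 (hDY hv)).2) ?_, hD⟩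
      obtain ⟨D', hD'C, hD'⟩ := hC
      obtain ⟨v, hv⟩ := hD.inter_nonempty hW hD'
      refine ⟨v, mem_inter.2 ⟨(mem_inter.1 hv).1, mem_erase.2 ⟨?_, hD'C (mem_inter.1 hv).2⟩⟩⟩
      rintro rfl
      exact hCY hxC (hDX (mem_inter.1 hv).1)
    have := hX _ hsubE hhost
    omega
  rw [erase_eq_of_notMem hxC] at hsubE hb hbL
  have hcard : (insert x X \ C).card = (X \ C).card + 1 := by
    rw [insert_sdiff_of_notMem _ hxC, card_insert_of_notMem fun h => hxX (mem_sdiff.1 h).1]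
  have hle := hX C hsubE hC
  refine ⟨C, ⟨hsubE, hC, by omega⟩, hxC, fun hxY u hu hux => ?_⟩
  have hxb : x ∈ outerBoundary G (Y ∪ insert x X) C :=
    mem_outerBoundary.2 ⟨mem_union_right _ (mem_insert_self _ _), hxC, u, hu, hux⟩
  have hxb' : x ∉ outerBoundary G (Y ∪ X) C := fun h =>
    (mem_union.1 (mem_outerBoundary.1 h).1).elim hxY hxX
  have hlt' := Nat.mul_lt_mul_of_pos_left
    (card_lt_card (Finset.ssubset_iff_subset_ne.2 ⟨hb, fun h => hxb' (h ▸ hxb)⟩)) hL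
  omega

theorem exists_isSpread {G : SimpleGraph V} {W Y : Finset V} {k p c L : ℕ}
    (hW : W.card ≤ 2 * k + 1) (hY : IsRobust G W k p Y) (hcp : 2 * c ≤ p) (hL : 0 < L)
    (huniv : IsRobust G W k (p + c) univ)
    (hgrow : ∀ t ≤ c, t * L ≤ minRobustCard G W k (p + t)) :
    ∃ X, IsSpread G W k L Y X ∧ c * L ≤ X.card := by
  obtain ⟨X, hX⟩ := Set.Finite.exists_maximal (s := {X | IsSpread G W k L Y X})
    (Set.toFinite _) ⟨∅, fun C _ _ => by simp⟩
  have hspread : IsSpread G W k L Y X := hX.prop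
  refine ⟨X, hspread, ?_⟩
  by_contra! hlt
  have hY2 := hY.mono hcp Subset.rfl
  obtain ⟨C, hC⟩ := Set.Finite.exists_minimal (s := {C | IsTight G W k L Y X C})
    (Set.toFinite _) ⟨Y ∪ X, Subset.rfl, hY.hosts.mono subset_union_left, by
      have : outerBoundary G (Y ∪ X) (Y ∪ X) = ∅ := by
        ext v
        simp only [mem_outerBoundary, notMem_empty, iff_false]
        tauto
      simp [this]⟩
  have hmin : ∀ C', IsTight G W k L Y X C' → C ⊆ C' := fun C' hC' =>
    (hC.le_of_le (hC.prop.inter hW hY2 hspread hlt hC') inter_subset_left).trans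
      inter_subset_right
  have hoff : ∀ x ∉ X, x ∉ C ∧ (x ∉ Y → ∀ u ∈ C, ¬ G.Adj u x) := by
    intro x hx
    obtain ⟨C', hC', hxC', hadj⟩ := exists_isTight_of_not_isSpread_insert hW
      (hY2.mono (by omega) Subset.rfl) hL hspread hlt hx fun h =>
        hx (hX.le_of_ge h (subset_insert x X) (mem_insert_self x X))
    exact ⟨fun h => hxC' (hmin C' hC' h), fun hxY u hu => hadj hxY u (hmin C' hC' hu)⟩
  obtain ⟨hCs, hhost, htight⟩ : IsTight G W k L Y X C := hC.prop
  have hCX : C ⊆ X := fun x hx => by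
    by_contra h
    exact (hoff x h).1 hx
  have hb : outerBoundary G univ C = outerBoundary G (Y ∪ X) C := by
    ext v
    simp only [mem_outerBoundary, mem_univ, true_and, mem_union]
    refine ⟨fun ⟨hv, u, hu, huv⟩ => ⟨?_, hv, u, hu, huv⟩, fun h => h.2⟩
    by_contra! h
    exact (hoff v h.2).2 h.1 u hu huv
  have hsc : (outerBoundary G (Y ∪ X) C).card ≤ c := by
    by_contra! h
    have h1 := Nat.mul_le_mul_left L h.le
    have h2 : (X \ C).card ≤ X.card := card_le_card sdiff_subset
    rw [mul_comm c L] at hlt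
    omega
  obtain ⟨t, ht⟩ := Nat.exists_eq_add_of_le hsc
  have hrob : IsRobust G W k (p + t) C := by
    refine IsRobust.of_card_outerBoundary_le hW (huniv.mono ?_ Subset.rfl) hhost
      (congrArg card hb).le
    omega
  have hCcard := (hgrow t (by omega)).trans (minRobustCard_le hrob)
  have hsum := card_sdiff_add_card_eq_card hCX
  have hcL : c * L = L * (outerBoundary G (Y ∪ X) C).card + t * L := by
    rw [mul_comm L, ← add_mul, ← ht]
  omega

theorem not_isRobust_univ {G : SimpleGraph V} {W : Finset V} {a : ℕ}
    (hW : W.card ≤ 2 * (35 * a) + 1) (hG : HasBalancedSeps G a) :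
    ¬ IsRobust G W (35 * a) (35 * a) univ := by
  intro h
  have hne : Nonempty V := by
    obtain ⟨x, -⟩ := card_pos.1 (Nat.zero_le _ |>.trans_lt h.hosts.lt_card)
    exact ⟨x⟩
  have ha := hG.pos
  obtain ⟨Y, hY, hYc⟩ := exists_card_eq_minRobustCard
    (h.mono (show 24 * a ≤ 35 * a by omega) Subset.rfl)
  have hn := hY.hosts.lt_card
  obtain ⟨L, hL1, hL2⟩ : ∃ L, 2 * (L * a) ≤ Y.card ∧ 3 * Y.card < 8 * (L * a) := by
    refine ⟨Y.card / (2 * a), ?_, ?_⟩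
    · have := Nat.div_mul_le_self Y.card (2 * a)
      linarith
    · have := Nat.lt_div_mul_add (a := Y.card) (b := 2 * a) (by omega)
      have he : Y.card / (2 * a) * (2 * a) = 2 * (Y.card / (2 * a) * a) := by ring
      omega
  have hL : 0 < L := by
    rcases Nat.eq_zero_or_pos L with rfl | h
    · omega
    · exact h
  obtain ⟨X, hX, hXc⟩ := exists_isSpread (c := 11 * a) hW hY (by omega) hL
    (h.mono (by omega) Subset.rfl) (by
      intro t ht
      have hdm := Nat.div_add_mod t a
      have hmod := Nat.mod_lt t ha
      have hra : t / a * a ≤ t := Nat.div_mul_le_self t a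
      have hlin := minRobustCard_linear_growth (j := 24 * a) hW hG (t / a)
        (h.mono (by omega) Subset.rfl)
      have hmono := minRobustCard_mono (i := 24 * a + t / a * a) (j := 24 * a + t)
        (h.mono (by omega) Subset.rfl) (by omega)
      rw [← hYc] at hlin
      have h1 : t * L ≤ (t / a + 1) * (L * a) := by
        have : t ≤ (t / a + 1) * a := by linarith
        calc t * L ≤ (t / a + 1) * a * L := Nat.mul_le_mul_right L this
          _ = _ := by ring
      have h2 := Nat.mul_le_mul_left (t / a + 1) hL1
      linarith)
  obtain ⟨C, hCs, hC, hbC, hCc⟩ := (hY.mono le_rfl (subset_union_left (s₂ := X))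
    ).exists_hosts_card_le hG (by omega)
  have h1 := (hX C hCs hC).trans (Nat.mul_le_mul_left L hbC)
  have h2 := card_sdiff_add_card_eq_card hCs
  have h3 : ((Y ∪ X) \ C).card ≤ Y.card + (X \ C).card := by
    rw [union_sdiff_distrib]
    exact (card_union_le _ _).trans (Nat.add_le_add_right (card_le_card sdiff_subset) _)
  have h4 : X.card ≤ (Y ∪ X).card := card_le_card subset_union_right
  have h5 : 11 * a * L = 11 * (L * a) := by ring
  omega

/-- Main theorem: the treewidth of a finite graph is at most 105 times its
separation number. -/
theorem treewidth_le_105_mul_sepNum (G : SimpleGraph V) :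
    treewidth G ≤ 105 * sepNum G := by
  have hG := hasBalancedSeps_sepNum G
  have htd : HasTDWidthLE G (3 * (35 * sepNum G)) := by
    refine hasTDWidthLE_of_forall_exists_separator fun W hW => ?_
    by_contra! hno
    refine not_isRobust_univ hW hG fun S hS => ?_
    obtain ⟨D, hD, hDS, hDW⟩ := hno S hS
    exact ⟨D, fun x hx => mem_sdiff.2 ⟨mem_univ x, disjoint_left.1 hDS hx⟩, hD, hDW⟩
  exact (Nat.sInf_le htd).trans (by omega)
end

section
/- Let G be a finite graph with tangle number tn(G) ≥ 2. Then tn(G) ≤ tw(G) + 1 ≤ (3/2)·tn(G), where tw(G) is the treewidth of G. -/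
open Finset

universe u

variable {V : Type u} [Fintype V] [DecidableEq V]

/-- `(A, B)` is a g-separation of `G`: a pair of subgraphs with `A ∪ B = G` and
`E(A) ∩ E(B) = ∅`.  Its order is `(A.verts ∩ B.verts).ncard`. -/
def IsGSep (G : SimpleGraph V) (A B : G.Subgraph) : Prop :=
  A ⊔ B = ⊤ ∧ A.edgeSet ∩ B.edgeSet = ∅

/-- `T` is a tangle of order `θ ≥ 1` in `G`. -/
def IsTangle (G : SimpleGraph V) (T : Set (G.Subgraph × G.Subgraph)) (θ : ℕ) : Prop :=
  1 ≤ θ ∧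
  (∀ p ∈ T, IsGSep G p.1 p.2) ∧
  (∀ A B : G.Subgraph, IsGSep G A B → (A.verts ∩ B.verts).ncard < θ →
    (A, B) ∈ T ∨ (B, A) ∈ T) ∧
  (∀ p₁ ∈ T, ∀ p₂ ∈ T, ∀ p₃ ∈ T, p₁.1 ⊔ p₂.1 ⊔ p₃.1 ≠ (⊤ : G.Subgraph)) ∧
  (∀ p ∈ T, p.1.verts ≠ Set.univ)

/-- The tangle number of `G`: the maximum order of a tangle in `G` (`0` if `G` has
no tangle). -/
noncomputable def tangleNum (G : SimpleGraph V) : ℕ :=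
  sSup {θ | ∃ T, IsTangle G T θ}

namespace SimpleGraph

/-- A tree can be rooted: every node has a parent, with the root its own parent. -/
theorem IsTree.exists_parent {ι : Type*} {T : SimpleGraph ι} (hT : T.IsTree) :
    ∃ (r : ι) (p : ι → ι) (d : ι → ℕ), (∀ x, ∃ k, p^[k] x = r) ∧
      (∀ x, p x ≠ x → d (p x) < d x) ∧ (∀ u v, T.Adj u v → p u = v ∨ p v = u) := by
  obtain ⟨r⟩ := hT.connected.nonempty
  choose P hP _ using hT.existsUnique_path r
  have hlen : ∀ x, x ≠ r → (P x).length = (P (P x).penultimate).length + 1 := by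
    intro x hx
    have hnil : ¬ (P x).Nil := fun h => hx h.eq.symm
    have h := hT.isAcyclic.path_concat (hP (P x).penultimate) (hP x)
      ((P x).adj_penultimate hnil) (by
        exact List.mem_of_mem_dropLast ((P x).penultimate_mem_dropLast_support hnil))
    have h' := congrArg Walk.length h
    simpa using h'
  have hr : (P r).penultimate = r := by
    have : P r = Walk.nil := Walk.eq_nil_iff_nil.2 (Walk.isPath_iff_nil.1 (hP r))
    rw [this]; simp
  refine ⟨r, fun x => (P x).penultimate, fun x => (P x).length, ?_, ?_, ?_⟩
  · intro x
    induction hn : (P x).length using Nat.strong_induction_on generalizing x with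
    | _ n ih =>
      by_cases hx : x = r
      · exact ⟨0, hx⟩
      · obtain ⟨k, hk⟩ := ih _ (by have := hlen x hx; omega) (P x).penultimate rfl
        exact ⟨k + 1, hk⟩
  · intro x hx
    have hxr : x ≠ r := by rintro rfl; exact hx hr
    have := hlen x hxr
    simp only; omega
  · intro u v huv
    by_cases hv : v ∈ (P u).support
    · exact Or.inl (hT.isAcyclic.eq_penultimate_of_adj_end (hP u) huv hv).symm
    · have := hT.isAcyclic.mem_support_of_ne_mem_support_of_adj_of_isPath (hP v) (hP u)
        huv.symm hv
      exact Or.inr (hT.isAcyclic.eq_penultimate_of_adj_end (hP v) huv.symm this).symm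

end SimpleGraph

/-- The descendants of `x` with respect to the parent function `p`, including `x` itself. -/
def descendants {ι : Type*} (p : ι → ι) (x : ι) : Set ι := {y | ∃ k, p^[k] y = x}

theorem mem_descendants_self {ι : Type*} (p : ι → ι) (x : ι) : x ∈ descendants p x := ⟨0, rfl⟩

theorem depth_le_of_mem_descendants {ι : Type*} {p : ι → ι} {d : ι → ℕ}
    (hd : ∀ x, p x ≠ x → d (p x) < d x) {x y : ι} (h : y ∈ descendants p x) : d x ≤ d y := by
  obtain ⟨k, hk⟩ := h
  induction k generalizing y with
  | zero => exact (congrArg d hk).ge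
  | succ k ih =>
    refine (ih hk).trans ?_
    by_cases hy : p y = y
    · rw [hy]
    · exact (hd y hy).le

theorem exists_child_of_mem_descendants {ι : Type*} {p : ι → ι} {x z : ι}
    (h : z ∈ descendants p x) (hne : z ≠ x) : ∃ y, p y = x ∧ y ≠ x ∧ z ∈ descendants p y := by
  obtain ⟨k, hk⟩ := h
  induction k generalizing z with
  | zero => exact absurd hk hne
  | succ k ih =>
    by_cases hz : p z = x
    · exact ⟨z, hz, hne, mem_descendants_self p z⟩
    · obtain ⟨y, h1, h2, j, hj⟩ := ih hz hk
      exact ⟨y, h1, h2, j + 1, hj⟩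

/-- A connected set of nodes of a rooted tree that avoids the edge above `y` and meets the
subtree below `y` lies in that subtree. -/
theorem subset_descendants_of_preconnected {ι : Type*} {T : SimpleGraph ι} {p : ι → ι}
    (hp : ∀ u v, T.Adj u v → p u = v ∨ p v = u) {S : Set ι} (hS : (T.induce S).Preconnected)
    {y z : ι} (hz : z ∈ S) (hzy : z ∈ descendants p y) (hy : ¬ (y ∈ S ∧ p y ∈ S)) :
    S ⊆ descendants p y := by
  intro x hx
  have := (SimpleGraph.reachable_iff_reflTransGen _ _).1 (hS ⟨z, hz⟩ ⟨x, hx⟩)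
  suffices H : ∀ b : S, Relation.ReflTransGen (T.induce S).Adj ⟨z, hz⟩ b →
      b.1 ∈ descendants p y from H _ this
  intro b hb
  induction hb with
  | refl => exact hzy
  | @tail b c _ hbc ih =>
    obtain ⟨k, hk⟩ := ih
    rcases hp _ _ (show T.Adj b.1 c.1 from hbc) with h | h
    · cases k with
      | zero =>
        have hby : b.1 = y := hk
        exact absurd ⟨hby ▸ b.2, by rw [← hby, h]; exact c.2⟩ hy
      | succ k => exact ⟨k, by rw [← h]; exact hk⟩
    · exact ⟨k + 1, by rw [Function.iterate_succ_apply, h]; exact hk⟩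

section TangleLowerBound

variable {G : SimpleGraph V} {T : Set (G.Subgraph × G.Subgraph)} {θ : ℕ}

/-- `W` induces the small side of a separation in `T`. -/
def IsSmallSet (T : Set (G.Subgraph × G.Subgraph)) (W : Set V) : Prop :=
  ∃ B, ((⊤ : G.Subgraph).induce W, B) ∈ T

/-- All edges leaving `W` start in `S ⊆ W`. -/
def IsBoundary (G : SimpleGraph V) (W S : Set V) : Prop :=
  S ⊆ W ∧ ∀ u ∈ W, u ∉ S → ∀ v, G.Adj u v → v ∈ W

omit [Fintype V] [DecidableEq V] in
theorem IsBoundary.union {W₁ W₂ S : Set V} (h₁ : IsBoundary G W₁ S) (h₂ : IsBoundary G W₂ S) :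
    IsBoundary G (W₁ ∪ W₂) S := by
  refine ⟨h₁.1.trans Set.subset_union_left, ?_⟩
  rintro u (hu | hu) huS v huv
  exacts [Or.inl (h₁.2 u hu huS v huv), Or.inr (h₂.2 u hu huS v huv)]

omit [Fintype V] [DecidableEq V] in
theorem IsBoundary.exists_isGSep {W S : Set V} (h : IsBoundary G W S) :
    ∃ B : G.Subgraph, IsGSep G ((⊤ : G.Subgraph).induce W) B ∧ W ∩ B.verts = S ∧
      B.verts = (W \ S)ᶜ := by
  refine ⟨⟨(W \ S)ᶜ, fun u v => G.Adj u v ∧ ¬ (u ∈ W ∧ v ∈ W), fun h => h.1, ?_, ?_⟩,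
    ⟨?_, ?_⟩, ?_, rfl⟩
  · rintro u v ⟨huv, hW⟩ hu
    exact hW ⟨hu.1, h.2 u hu.1 hu.2 v huv⟩
  · refine ⟨?_⟩
    rintro u v ⟨huv, hW⟩
    exact ⟨huv.symm, fun h => hW ⟨h.2, h.1⟩⟩
  · ext u v
    · simp
      tauto
    · simp
      tauto
  · ext e
    induction e with
    | _ u v =>
      simp
      tauto
  · ext u
    have := @h.1 u
    simp
    tauto

omit [Fintype V] [DecidableEq V] in
theorem IsTangle.isSmallSet_of_le_sup (hT : IsTangle G T θ) {W S : Set V}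
    (h : IsBoundary G W S) (hS : S.ncard < θ) {p q : G.Subgraph × G.Subgraph} (hp : p ∈ T)
    (hq : q ∈ T) (hle : (⊤ : G.Subgraph).induce W ≤ p.1 ⊔ q.1) : IsSmallSet T W := by
  obtain ⟨B, hB, hBS, -⟩ := h.exists_isGSep
  rcases hT.2.2.1 _ B hB (by simpa [hBS] using hS) with h | h
  · exact ⟨B, h⟩
  · refine absurd (top_le_iff.1 ?_) (hT.2.2.2.1 p hp q hq _ h)
    rw [← hB.1]
    exact sup_le_sup_right hle B

omit [Fintype V] [DecidableEq V] in
theorem IsTangle.isSmallSet_of_ncard_lt (hT : IsTangle G T θ) {W : Set V}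
    (hW : W.ncard < θ) : IsSmallSet T W := by
  obtain ⟨B, hB, hBS, hBv⟩ := IsBoundary.exists_isGSep (G := G) (W := W) (S := W)
    ⟨subset_rfl, fun u hu hu' => absurd hu hu'⟩
  rcases hT.2.2.1 _ B hB (by simpa [hBS] using hW) with h | h
  · exact ⟨B, h⟩
  · exact absurd (by simp [hBv]) (hT.2.2.2.2 _ h)

omit [Fintype V] [DecidableEq V] in
/-- The edges inside `W` are edges inside `W₁` or `W₂`. -/
theorem IsTangle.isSmallSet_of_edges (hT : IsTangle G T θ) {W S W₁ W₂ : Set V}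
    (h : IsBoundary G W S) (hS : S.ncard < θ) (h₁ : IsSmallSet T W₁) (h₂ : IsSmallSet T W₂)
    (hW : W ⊆ W₁ ∪ W₂)
    (hedge : ∀ u ∈ W, ∀ v ∈ W, G.Adj u v → (u ∈ W₁ ∧ v ∈ W₁) ∨ (u ∈ W₂ ∧ v ∈ W₂)) :
    IsSmallSet T W := by
  obtain ⟨B₁, h₁⟩ := h₁
  obtain ⟨B₂, h₂⟩ := h₂
  refine hT.isSmallSet_of_le_sup h hS h₁ h₂ ⟨hW, ?_⟩
  rintro u v ⟨hu, hv, huv⟩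
  rcases hedge u hu v hv huv with h | h
  · exact Or.inl ⟨h.1, h.2, huv⟩
  · exact Or.inr ⟨h.1, h.2, huv⟩

omit [Fintype V] [DecidableEq V] in
theorem IsTangle.isSmallSet_union (hT : IsTangle G T θ) {S W₁ W₂ : Set V}
    (hS : S.ncard < θ) (hb₁ : IsBoundary G W₁ S) (hb₂ : IsBoundary G W₂ S)
    (h₁ : IsSmallSet T W₁) (h₂ : IsSmallSet T W₂) : IsSmallSet T (W₁ ∪ W₂) := by
  refine hT.isSmallSet_of_edges (hb₁.union hb₂) hS h₁ h₂ subset_rfl fun u hu v hv huv => ?_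
  by_cases huS : u ∈ S
  · by_cases hvS : v ∈ S
    · exact Or.inl ⟨hb₁.1 huS, hb₁.1 hvS⟩
    · rcases hv with hv | hv
      · exact Or.inl ⟨hb₁.2 v hv hvS u huv.symm, hv⟩
      · exact Or.inr ⟨hb₂.2 v hv hvS u huv.symm, hv⟩
  · rcases hu with hu | hu
    · exact Or.inl ⟨hu, hb₁.2 u hu huS v huv⟩
    · exact Or.inr ⟨hu, hb₂.2 u hu huS v huv⟩

omit [Fintype V] [DecidableEq V] in
theorem IsTangle.isSmallSet_biUnion (hT : IsTangle G T θ) {S : Set V} (hS : S.ncard < θ)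
    {α : Type*} (s : Finset α) (W : α → Set V) (hb : ∀ i ∈ s, IsBoundary G (W i) S)
    (h : ∀ i ∈ s, IsSmallSet T (W i)) :
    IsBoundary G (S ∪ ⋃ i ∈ s, W i) S ∧ IsSmallSet T (S ∪ ⋃ i ∈ s, W i) := by
  classical
  induction s using Finset.induction_on with
  | empty =>
    simpa using ⟨⟨subset_rfl, fun u hu hu' => absurd hu hu'⟩, hT.isSmallSet_of_ncard_lt hS⟩
  | insert a s _ ih =>
    obtain ⟨h1, h2⟩ := ih (fun i hi => hb i (Finset.mem_insert_of_mem hi))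
      (fun i hi => h i (Finset.mem_insert_of_mem hi))
    have hba := hb a (Finset.mem_insert_self a s)
    rw [Finset.set_biUnion_insert, Set.union_left_comm]
    exact ⟨hba.union h1, hT.isSmallSet_union hS hba h1 (h a (Finset.mem_insert_self a s)) h2⟩

/-- A tangle has order at most the largest bag size of any tree decomposition. -/
theorem IsTangle.le_of_hasTDWidthLE (hT : IsTangle G T θ) {w : ℕ} (h : HasTDWidthLE G w) :
    θ ≤ w + 1 := by
  obtain ⟨ι, Tr, β, hTr, -, hedge, hconn, hcard⟩ := h
  by_contra! hlt
  have hβ : ∀ x, ((β x : Set V)).ncard < θ := fun x => by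
    rw [Set.ncard_coe_finset]
    exact (hcard x).trans_lt hlt
  obtain ⟨r, p, d, hr, hd, hp⟩ := hTr.exists_parent
  let U : ι → Set V := fun x => {v | ∀ t, v ∈ β t → t ∈ descendants p x}
  have hmem : ∀ v, ∃ t, v ∈ β t := fun v => by
    obtain ⟨t⟩ := (hconn v).nonempty
    exact ⟨t.1, t.2⟩
  have hsub : ∀ v y z, v ∈ β z → z ∈ descendants p y → ¬ (v ∈ β y ∧ v ∈ β (p y)) → v ∈ U y :=
    fun v y z hz hzy hy => subset_descendants_of_preconnected hp (hconn v).preconnected hz hzy hy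
  have hclosed : ∀ y, ∀ v ∈ U y, ∀ u, G.Adj v u → u ∉ U y → u ∈ β y ∧ u ∈ β (p y) := by
    intro y v hv u hvu hu
    obtain ⟨t, htv, htu⟩ := hedge v u hvu
    by_contra hcon
    exact hu (hsub u y t htu (hv t htv) hcon)
  have hbd : ∀ y, IsBoundary G (U y ∪ β y) (β y) := fun y => by
    refine ⟨Set.subset_union_right, ?_⟩
    rintro v (hv | hv) hvS u hvu
    · by_cases hu : u ∈ U y
      · exact Or.inl hu
      · exact Or.inr (hclosed y v hv u hvu hu).1
    · exact absurd hv hvS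
  choose t ht using hmem
  have key : ∀ n x, (∑ v, d (t v)) + 1 ≤ d x + n → IsSmallSet T (U x ∪ β x) := by
    intro n
    induction n with
    | zero =>
      intro x hx
      have hU : U x = ∅ := by
        rw [Set.eq_empty_iff_forall_notMem]
        intro v hv
        have h1 := depth_le_of_mem_descendants hd (hv _ (ht v))
        have h2 : d (t v) ≤ ∑ v, d (t v) :=
          Finset.single_le_sum (f := fun v => d (t v)) (fun _ _ => Nat.zero_le _)
            (Finset.mem_univ v)
        omega
      rw [hU, Set.empty_union]
      exact hT.isSmallSet_of_ncard_lt (hβ x)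
    | succ n ih =>
      intro x hx
      have child : ∀ y, p y = x → y ≠ x →
          IsBoundary G (U y ∪ β x) (β x) ∧ IsSmallSet T (U y ∪ β x) := by
        intro y hyx hne
        have hb : IsBoundary G (U y ∪ β x) (β x) := by
          refine ⟨Set.subset_union_right, ?_⟩
          rintro v (hv | hv) hvS u hvu
          · by_cases hu : u ∈ U y
            · exact Or.inl hu
            · exact Or.inr (hyx ▸ (hclosed y v hv u hvu hu).2)
          · exact absurd hv hvS
        have hlt := hd y (by rw [hyx]; exact hne.symm)
        rw [hyx] at hlt
        refine ⟨hb, hT.isSmallSet_of_edges hb (hβ x) (ih y (by omega))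
          (hT.isSmallSet_of_ncard_lt (hβ x)) ?_ ?_⟩
        · rintro v (hv | hv)
          exacts [Or.inl (Or.inl hv), Or.inr hv]
        · have step : ∀ u ∈ U y, ∀ v, G.Adj u v → u ∈ U y ∪ β y ∧ v ∈ U y ∪ β y := by
            intro u hu v huv
            refine ⟨Or.inl hu, ?_⟩
            by_cases hv : v ∈ U y
            · exact Or.inl hv
            · exact Or.inr (hclosed y u hu v huv hv).1
          rintro u (hu | hu) v (hv | hv) huv
          · exact Or.inl (step u hu v huv)
          · exact Or.inl (step u hu v huv)
          · exact Or.inl (step v hv u huv.symm).symm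
          · exact Or.inr ⟨hu, hv⟩
      have hchild : ∀ v, ∃ y, v ∈ U x → v ∉ β x → p y = x ∧ y ≠ x ∧ v ∈ U y := by
        intro v
        by_cases hv : v ∈ U x ∧ v ∉ β x
        · obtain ⟨y, hyx, hne, hy⟩ := exists_child_of_mem_descendants (hv.1 _ (ht v))
            (fun h => hv.2 (h ▸ ht v))
          exact ⟨y, fun _ _ => ⟨hyx, hne, hsub v y _ (ht v) hy fun h => hv.2 (hyx ▸ h.2)⟩⟩
        · exact ⟨x, fun h h' => absurd ⟨h, h'⟩ hv⟩
      choose c hc using hchild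
      classical
      let s : Finset V := Finset.univ.filter fun v => v ∈ U x ∧ v ∉ β x
      have hs : ∀ v ∈ s, p (c v) = x ∧ c v ≠ x ∧ v ∈ U (c v) := fun v hv => by
        obtain ⟨h1, h2⟩ := (Finset.mem_filter.1 hv).2
        exact hc v h1 h2
      obtain ⟨-, hsmall⟩ := hT.isSmallSet_biUnion (hβ x) s (fun v => U (c v) ∪ β x)
        (fun v hv => (child _ (hs v hv).1 (hs v hv).2.1).1)
        (fun v hv => (child _ (hs v hv).1 (hs v hv).2.1).2)
      have hle : U x ∪ β x ⊆ (β x : Set V) ∪ ⋃ v ∈ s, (U (c v) ∪ β x) := by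
        intro v hv
        by_cases hvx : v ∈ β x
        · exact Or.inl hvx
        · have hv' : v ∈ U x := hv.resolve_right hvx
          have hvs : v ∈ s := Finset.mem_filter.2 ⟨Finset.mem_univ v, hv', hvx⟩
          exact Or.inr (Set.mem_biUnion hvs (Or.inl (hs v hvs).2.2))
      exact hT.isSmallSet_of_edges (hbd x) (hβ x) hsmall hsmall
        (hle.trans Set.subset_union_left)
        fun u hu v hv _ => Or.inl ⟨hle hu, hle hv⟩
  obtain ⟨B, hB⟩ := key _ r le_add_self
  refine hT.2.2.2.2 _ hB (Set.eq_univ_of_forall fun v => Or.inl fun t _ => hr t)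

end TangleLowerBound

/-- `X` arises from members of `N` by repeatedly forming disjoint unions
of value less than `k` under `f`. -/
inductive DisjUnionGen {E : Type*} [DecidableEq E] (f : Finset E → ℕ) (k : ℕ)
    (N : Set (Finset E)) : Finset E → Prop
  | base {X : Finset E} : X ∈ N → DisjUnionGen f k N X
  | union {X Y : Finset E} : DisjUnionGen f k N X → DisjUnionGen f k N Y → Disjoint X Y →
      f (X ∪ Y) < k → DisjUnionGen f k N (X ∪ Y)

theorem DisjUnionGen.lt {E : Type*} [DecidableEq E] {f : Finset E → ℕ} {k : ℕ}
    {N : Set (Finset E)} (hN : ∀ X ∈ N, f X < k) {X : Finset E} (h : DisjUnionGen f k N X) :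
    f X < k := by
  cases h with
  | base h => exact hN _ h
  | union _ _ _ h => exact h

/-- A connectivity function: symmetric and submodular. -/
structure IsConnectivityFun {E : Type*} [Fintype E] [DecidableEq E] (f : Finset E → ℕ) :
    Prop where
  compl (X : Finset E) : f Xᶜ = f X
  submod (X Y : Finset E) : f (X ∩ Y) + f (X ∪ Y) ≤ f X + f Y

section Connectivity

variable {E : Type*} [Fintype E] [DecidableEq E] {f : Finset E → ℕ} {k : ℕ}
  {N : Set (Finset E)}

/-- If `Z` minimizes `f` between `X` and `Z`, removing `Z` from a set disjoint from `X` does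
not increase `f`. -/
theorem IsConnectivityFun.map_sdiff_le (hf : IsConnectivityFun f) {X Z : Finset E}
    (hXZ : X ⊆ Z) (hmin : ∀ Z', X ⊆ Z' → Z' ⊆ Z → f Z ≤ f Z') {W : Finset E}
    (hW : Disjoint W X) : f (W \ Z) ≤ f W := by
  have h1 := hf.submod Wᶜ Z
  have h2 : f Z ≤ f (Wᶜ ∩ Z) := hmin _ (by
    rw [Finset.subset_inter_iff]
    exact ⟨Finset.subset_compl_iff_disjoint_left.2 hW, hXZ⟩) Finset.inter_subset_right
  have h3 : f (Wᶜ ∪ Z) = f (W \ Z) := by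
    rw [← hf.compl]; congr 1; ext; simp
  have := hf.compl W
  omega

theorem DisjUnionGen.sdiff (hf : IsConnectivityFun f) (hN : ∀ X ∈ N, f X < k)
    (hdown : ∀ X ∈ N, ∀ Y ⊆ X, f Y < k → Y ∈ N) {X Z : Finset E} (hXZ : X ⊆ Z)
    (hmin : ∀ Z', X ⊆ Z' → Z' ⊆ Z → f Z ≤ f Z') {W : Finset E} (h : DisjUnionGen f k N W)
    (hW : Disjoint W X) : DisjUnionGen f k N (W \ Z) := by
  induction h with
  | @base W h =>
    exact .base (hdown W h _ Finset.sdiff_subset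
      ((hf.map_sdiff_le hXZ hmin hW).trans_lt (hN W h)))
  | @union A B _ _ hd hlt ihA ihB =>
    have hle := (hf.map_sdiff_le hXZ hmin hW).trans_lt hlt
    rw [Finset.disjoint_union_left] at hW
    rw [Finset.union_sdiff_distrib] at hle ⊢
    exact .union (ihA hW.1) (ihB hW.2)
      (hd.mono Finset.sdiff_subset Finset.sdiff_subset) hle

/-- Re-rooting a derivation that uses the set `X` at `X`, and shifting it to `Z ⊇ X`. -/
theorem DisjUnionGen.compl_of_insert (hf : IsConnectivityFun f) (hN : ∀ X ∈ N, f X < k)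
    (hdown : ∀ X ∈ N, ∀ Y ⊆ X, f Y < k → Y ∈ N) {X Z : Finset E} (hX : X.Nonempty)
    (hXk : f X < k) (hXZ : X ⊆ Z)
    (hmin : ∀ Z', X ⊆ Z' → Z' ⊆ Z → f Z ≤ f Z') {W : Finset E}
    (h : DisjUnionGen f k (insert X N) W) :
    DisjUnionGen f k N W ∨
      X ⊆ W ∧ (DisjUnionGen f k N (Wᶜ \ Z) → DisjUnionGen f k N Zᶜ) := by
  have hN' : ∀ Y ∈ insert X N, f Y < k := by
    rintro Y (rfl | hY)
    exacts [hXk, hN Y hY]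
  have key : ∀ A B : Finset E, f B < k → Disjoint A B → DisjUnionGen f k N A → X ⊆ B →
      (DisjUnionGen f k N (Bᶜ \ Z) → DisjUnionGen f k N Zᶜ) →
      DisjUnionGen f k N ((A ∪ B)ᶜ \ Z) → DisjUnionGen f k N Zᶜ := by
    intro A B hB hd hA hXB hBZ hABZ
    apply hBZ
    have hdisj : Disjoint A X := hd.mono_right hXB
    have hle : f (Bᶜ \ Z) ≤ f Bᶜ := hf.map_sdiff_le hXZ hmin
      (Finset.disjoint_left.2 fun e he heX => Finset.mem_compl.1 he (hXB heX))
    rw [hf.compl] at hle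
    have heq : Bᶜ \ Z = ((A ∪ B)ᶜ \ Z) ∪ (A \ Z) := by
      ext e
      have := fun h : e ∈ A => Finset.disjoint_left.1 hd h
      simp only [Finset.mem_sdiff, Finset.mem_compl, Finset.mem_union]
      tauto
    rw [heq] at hle ⊢
    refine .union hABZ (hA.sdiff hf hN hdown hXZ hmin hdisj) ?_ (hle.trans_lt hB)
    rw [Finset.disjoint_left]
    intro e
    simp only [Finset.mem_sdiff, Finset.mem_compl, Finset.mem_union]
    tauto
  induction h with
  | @base W h =>
    rcases h with rfl | h
    · refine Or.inr ⟨subset_rfl, fun h => ?_⟩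
      have : Zᶜ = Wᶜ \ Z := by
        ext e
        have := @hXZ e
        simp only [Finset.mem_sdiff, Finset.mem_compl]
        tauto
      rwa [this]
    · exact Or.inl (.base h)
  | @union A B hA hB hd hlt ihA ihB =>
    rcases ihA with ihA | ihA <;> rcases ihB with ihB | ihB
    · exact Or.inl (.union ihA ihB hd hlt)
    · exact Or.inr ⟨ihB.1.trans Finset.subset_union_right,
        key A B (hB.lt hN') hd ihA ihB.1 ihB.2⟩
    · refine Or.inr ⟨ihA.1.trans Finset.subset_union_left, ?_⟩
      rw [Finset.union_comm]
      exact key B A (hA.lt hN') hd.symm ihB ihA.1 ihA.2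
    · obtain ⟨e, he⟩ := hX
      exact absurd (ihB.1 he) (Finset.disjoint_left.1 hd (ihA.1 he))

theorem DisjUnionGen.compl_of_univ (hf : IsConnectivityFun f) (hN : ∀ X ∈ N, f X < k)
    (hdown : ∀ X ∈ N, ∀ Y ⊆ X, f Y < k → Y ∈ N) (hempty : ∅ ∈ N) {X Z : Finset E}
    (hXN : X ∉ N) (hXk : f X < k) (hXZ : X ⊆ Z)
    (hmin : ∀ Z', X ⊆ Z' → Z' ⊆ Z → f Z ≤ f Z') (huniv : ¬ DisjUnionGen f k N Finset.univ)
    (h : DisjUnionGen f k (insert X N) Finset.univ) : DisjUnionGen f k N Zᶜ := by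
  have hX : X.Nonempty := by
    rw [Finset.nonempty_iff_ne_empty]
    rintro rfl
    exact hXN hempty
  rcases h.compl_of_insert hf hN hdown hX hXk hXZ hmin with h | h
  · exact absurd h huniv
  · exact h.2 (by simpa using DisjUnionGen.base hempty)

/-- Tangle duality for connectivity functions: if the ground set is not generated from a
down-closed family `N₀`, then `N₀` extends to a down-closed orientation of all sets of value
less than `k` that still does not generate the ground set. -/
theorem IsConnectivityFun.exists_orientation (hf : IsConnectivityFun f)
    {N₀ : Set (Finset E)} (hN₀ : ∀ X ∈ N₀, f X < k)
    (hdown₀ : ∀ X ∈ N₀, ∀ Y ⊆ X, f Y < k → Y ∈ N₀) (hempty : ∅ ∈ N₀)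
    (huniv₀ : ¬ DisjUnionGen f k N₀ Finset.univ) :
    ∃ N, N₀ ⊆ N ∧ (∀ X ∈ N, f X < k) ∧ (∀ X ∈ N, ∀ Y ⊆ X, f Y < k → Y ∈ N) ∧
      ¬ DisjUnionGen f k N Finset.univ ∧ ∀ X, f X < k → X ∈ N ∨ Xᶜ ∈ N := by
  obtain ⟨N, hle, ⟨hN, hdown, huniv⟩, hmax⟩ := Finite.exists_le_maximal
    (p := fun N : Set (Finset E) => (∀ X ∈ N, f X < k) ∧
      (∀ X ∈ N, ∀ Y ⊆ X, f Y < k → Y ∈ N) ∧ ¬ DisjUnionGen f k N Finset.univ)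
    ⟨hN₀, hdown₀, huniv₀⟩
  replace hempty : ∅ ∈ N := hle hempty
  refine ⟨N, hle, hN, hdown, huniv, fun X hX => ?_⟩
  by_contra! hXN
  have minimal : ∀ A, f A < k → A ∉ N → ∃ A' ⊆ A, f A' < k ∧ A' ∉ N ∧
      DisjUnionGen f k (insert A' N) Finset.univ := by
    intro A hA hAN
    obtain ⟨A', hA'A, ⟨hA', hA'N⟩, hA'min⟩ := Finite.exists_le_minimal
      (p := fun A => f A < k ∧ A ∉ N) ⟨hA, hAN⟩
    refine ⟨A', hA'A, hA', hA'N, ?_⟩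
    by_contra hgen
    refine hA'N (hmax (y := insert A' N) ⟨?_, ?_, hgen⟩ (Set.subset_insert _ _)
      (Set.mem_insert _ _))
    · rintro B (rfl | hB)
      exacts [hA', hN B hB]
    · rintro B (rfl | hB) C hCB hC
      · by_cases hCN : C ∈ N
        · exact Or.inr hCN
        · exact Or.inl (hCB.antisymm (hA'min ⟨hC, hCN⟩ hCB))
      · exact Or.inr (hdown B hB C hCB hC)
  obtain ⟨A, hAX, hA, hAN, hAgen⟩ := minimal X hX hXN.1
  obtain ⟨B, hBX, hB, hBN, hBgen⟩ := minimal Xᶜ (by rwa [hf.compl]) hXN.2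
  have hAB : A ⊆ Bᶜ := fun e he => by
    rw [Finset.mem_compl]
    exact fun heB => Finset.mem_compl.1 (hBX heB) (hAX he)
  obtain ⟨Z, hZ, hZmin⟩ := Finset.exists_min_image (Finset.Icc A Bᶜ) f
    ⟨A, Finset.mem_Icc.2 ⟨le_rfl, hAB⟩⟩
  obtain ⟨hAZ, hZB⟩ := Finset.mem_Icc.1 hZ
  have h1 : DisjUnionGen f k N Zᶜ := hAgen.compl_of_univ hf hN hdown hempty hAN hA hAZ
    (fun Z' h h' => hZmin Z' (Finset.mem_Icc.2 ⟨h, h'.trans hZB⟩)) huniv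
  have h2 : DisjUnionGen f k N Zᶜᶜ := by
    refine hBgen.compl_of_univ hf hN hdown hempty hBN hB
      (Finset.subset_compl_comm.1 hZB) (fun Z' h h' => ?_) huniv
    rw [hf.compl, ← hf.compl Z']
    exact hZmin _ (Finset.mem_Icc.2 ⟨hAZ.trans (Finset.subset_compl_comm.1 h'),
      Finset.compl_subset_compl.2 h⟩)
  rw [compl_compl] at h2
  refine huniv ?_
  have h3 := DisjUnionGen.union h2 h1 disjoint_compl_right (by
    rw [Finset.union_compl, ← Finset.compl_empty, hf.compl]
    exact hN _ hempty)
  rwa [Finset.union_compl] at h3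

/-- Three members of an orientation that does not generate the ground set do not cover it. -/
theorem IsConnectivityFun.union_ne_univ (hf : IsConnectivityFun f) (hN : ∀ X ∈ N, f X < k)
    (hdown : ∀ X ∈ N, ∀ Y ⊆ X, f Y < k → Y ∈ N) (hempty : ∅ ∈ N)
    (huniv : ¬ DisjUnionGen f k N Finset.univ) {A B C : Finset E} (hA : A ∈ N) (hB : B ∈ N)
    (hC : C ∈ N) : A ∪ B ∪ C ≠ Finset.univ := by
  have uncross : ∀ X ∈ N, ∀ Y ∈ N, ∃ X' ∈ N, ∃ Y' ∈ N,
      X' ⊆ X ∧ Y' ⊆ Y ∧ Disjoint X' Y' ∧ X' ∪ Y' = X ∪ Y := by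
    intro X hX Y hY
    have h := hf.submod X Yᶜ
    rw [hf.compl, ← hf.compl (X ∪ Yᶜ)] at h
    have h1 : X ∩ Yᶜ = X \ Y := by ext; simp
    have h2 : (X ∪ Yᶜ)ᶜ = Y \ X := by ext; simp [and_comm]
    rw [h1, h2] at h
    have hXk := hN X hX
    have hYk := hN Y hY
    rcases le_or_gt (f (X \ Y)) (f X) with h3 | h3
    · exact ⟨X \ Y, hdown X hX _ Finset.sdiff_subset (by omega), Y, hY, Finset.sdiff_subset,
        subset_rfl, Finset.sdiff_disjoint, Finset.sdiff_union_self_eq_union⟩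
    · exact ⟨X, hX, Y \ X, hdown Y hY _ Finset.sdiff_subset (by omega), subset_rfl,
        Finset.sdiff_subset, Finset.disjoint_sdiff, Finset.union_sdiff_self_eq_union⟩
  intro h
  obtain ⟨A₁, hA₁, B₁, hB₁, -, -, hd₁, he₁⟩ := uncross A hA B hB
  obtain ⟨A₂, hA₂, C₂, hC₂, hs₂, -, hd₂, he₂⟩ := uncross A₁ hA₁ C hC
  obtain ⟨B₃, hB₃, C₃, hC₃, hs₃, hs₃', hd₃, he₃⟩ := uncross B₁ hB₁ C₂ hC₂
  have hAB : Disjoint A₂ B₃ := hd₁.mono hs₂ hs₃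
  have hAC : Disjoint A₂ C₃ := hd₂.mono_right hs₃'
  have hcover : A₂ ∪ (B₃ ∪ C₃) = Finset.univ := by
    rw [he₃, Finset.union_left_comm, he₂, ← h, ← he₁, ← Finset.union_assoc, Finset.union_comm B₁]
  have hd : Disjoint A₂ (B₃ ∪ C₃) := Finset.disjoint_union_right.2 ⟨hAB, hAC⟩
  have hBC : B₃ ∪ C₃ = A₂ᶜ := by
    refine Finset.Subset.antisymm (Finset.subset_compl_iff_disjoint_left.2 hd) fun e he => ?_
    have : e ∈ A₂ ∪ (B₃ ∪ C₃) := hcover ▸ Finset.mem_univ e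
    exact (Finset.mem_union.1 this).resolve_left (Finset.mem_compl.1 he)
  refine huniv (hcover ▸ .union (.base hA₂) (.union (.base hB₃) (.base hC₃) hd₃ ?_) hd ?_)
  · rw [hBC, hf.compl]
    exact hN _ hA₂
  · rw [hcover, ← Finset.compl_empty, hf.compl]
    exact hN _ hempty

end Connectivity

theorem SimpleGraph.IsAcyclic.isBridge_map {γ δ : Type*} {K : SimpleGraph γ} {L : SimpleGraph δ}
    (hK : K.IsAcyclic) (f : K ↪g L) (hf : ∀ c x, L.Adj (f c) x → x ∈ Set.range f) {u v : γ}
    (huv : K.Adj u v) : L.IsBridge s(f u, f v) := by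
  have hb := SimpleGraph.isAcyclic_iff_forall_adj_isBridge.1 hK huv
  rw [SimpleGraph.isBridge_iff] at hb ⊢
  intro hreach
  apply hb
  rw [SimpleGraph.reachable_iff_reflTransGen] at hreach
  suffices H : ∀ b, Relation.ReflTransGen (L.deleteEdges {s(f u, f v)}).Adj (f u) b →
      ∃ c, f c = b ∧ (K.deleteEdges {s(u, v)}).Reachable u c by
    obtain ⟨c, hc, h⟩ := H _ hreach
    rwa [f.injective hc] at h
  intro b hb
  induction hb with
  | refl => exact ⟨u, rfl, .refl _⟩
  | tail _ hadj ih =>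
    obtain ⟨c, rfl, hc⟩ := ih
    rw [SimpleGraph.deleteEdges_adj] at hadj
    obtain ⟨x, rfl⟩ := hf _ _ hadj.1
    refine ⟨x, rfl, hc.trans (SimpleGraph.Adj.reachable ?_)⟩
    rw [SimpleGraph.deleteEdges_adj]
    refine ⟨f.map_adj_iff.1 hadj.1, fun h => hadj.2 ?_⟩
    have := congrArg (Sym2.map f) h
    simpa using this


theorem SimpleGraph.IsAcyclic.sum {α β : Type*} {G : SimpleGraph α} {H : SimpleGraph β}
    (hG : G.IsAcyclic) (hH : H.IsAcyclic) : (G ⊕g H).IsAcyclic := by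
  rw [SimpleGraph.isAcyclic_iff_forall_adj_isBridge]
  rintro (u | u) (v | v) huv
  · refine hG.isBridge_map (SimpleGraph.Embedding.sumInl (H := H)) ?_ huv
    rintro c (x | x) h
    exacts [⟨x, rfl⟩, absurd h (by simp)]
  · simp at huv
  · simp at huv
  · refine hH.isBridge_map (SimpleGraph.Embedding.sumInr (G := G)) ?_ huv
    rintro c (x | x) h
    exacts [absurd h (by simp), ⟨x, rfl⟩]

theorem SimpleGraph.IsTree.sum_sup_edge {α β : Type*} {G : SimpleGraph α} {H : SimpleGraph β}
    (hG : G.IsTree) (hH : H.IsTree) (a : α) (b : β) :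
    ((G ⊕g H) ⊔ SimpleGraph.edge (Sum.inl a) (Sum.inr b)).IsTree :=
  ⟨hG.connected.sum_sup_edge hH.connected, (hG.isAcyclic.sum hH.isAcyclic).sup_edge_of_not_reachable
    (SimpleGraph.not_reachable_sum_inl_inr a b)⟩

section RootedTD

omit [Fintype V]

/-- There is a tree decomposition with bags of size at most `b`, one of which is `R`, whose
bags have union `U` and cover each set in `C`. -/
def HasRootedTD (b : ℕ) (C : Set (Finset V)) (U R : Finset V) : Prop :=
  ∃ (ι : Type u) (T : SimpleGraph ι) (β : ι → Finset V) (r : ι),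
    T.IsTree ∧ β r = R ∧ (∀ v, v ∈ U ↔ ∃ t, v ∈ β t) ∧ (∀ c ∈ C, ∃ t, c ⊆ β t) ∧
    (∀ v ∈ U, (T.induce {t | v ∈ β t}).Connected) ∧ ∀ t, (β t).card ≤ b

omit [DecidableEq V] in
theorem HasRootedTD.single {b : ℕ} {R : Finset V} (h : R.card ≤ b) :
    HasRootedTD b {R} R R := by
  refine ⟨PUnit, ⊥, fun _ => R, PUnit.unit, .of_subsingleton, rfl, by simp, by simp, ?_,
    fun _ => h⟩
  intro v hv
  have : Nonempty {t : PUnit | v ∈ R} := ⟨⟨PUnit.unit, hv⟩⟩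
  exact (SimpleGraph.IsTree.of_subsingleton).connected

theorem HasRootedTD.join {b : ℕ} {C₁ C₂ : Set (Finset V)} {U₁ U₂ R₁ R₂ : Finset V}
    (h₁ : HasRootedTD b C₁ U₁ R₁) (h₂ : HasRootedTD b C₂ U₂ R₂)
    (h : ∀ v ∈ U₁, v ∈ U₂ → v ∈ R₁ ∧ v ∈ R₂) :
    HasRootedTD b (C₁ ∪ C₂) (U₁ ∪ U₂) R₁ := by
  obtain ⟨ι₁, T₁, β₁, r₁, hT₁, hr₁, hU₁, hC₁, hconn₁, hb₁⟩ := h₁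
  obtain ⟨ι₂, T₂, β₂, r₂, hT₂, hr₂, hU₂, hC₂, hconn₂, hb₂⟩ := h₂
  let T := (T₁ ⊕g T₂) ⊔ SimpleGraph.edge (Sum.inl r₁) (Sum.inr r₂)
  refine ⟨ι₁ ⊕ ι₂, T, Sum.elim β₁ β₂, Sum.inl r₁, hT₁.sum_sup_edge hT₂ r₁ r₂, by simpa using hr₁,
    ?_, ?_, ?_, ?_⟩
  · intro v
    simp [hU₁, hU₂]
  · rintro c (hc | hc)
    · obtain ⟨t, ht⟩ := hC₁ c hc
      exact ⟨Sum.inl t, ht⟩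
    · obtain ⟨t, ht⟩ := hC₂ c hc
      exact ⟨Sum.inr t, ht⟩
  · intro v hv
    let S : Set (ι₁ ⊕ ι₂) := {t | v ∈ Sum.elim β₁ β₂ t}
    let f₁ : T₁.induce {t | v ∈ β₁ t} →g T.induce S :=
      ⟨fun t => ⟨Sum.inl t.1, t.2⟩, fun {a b} hab => Or.inl hab⟩
    let f₂ : T₂.induce {t | v ∈ β₂ t} →g T.induce S :=
      ⟨fun t => ⟨Sum.inr t.1, t.2⟩, fun {a b} hab => Or.inl hab⟩
    have c₁ : ∀ x y (hx : v ∈ β₁ x) (hy : v ∈ β₁ y),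
        (T.induce S).Reachable ⟨Sum.inl x, hx⟩ ⟨Sum.inl y, hy⟩ := fun x y hx hy =>
      ((hconn₁ v ((hU₁ v).2 ⟨x, hx⟩)).preconnected ⟨x, hx⟩ ⟨y, hy⟩).map f₁
    have c₂ : ∀ x y (hx : v ∈ β₂ x) (hy : v ∈ β₂ y),
        (T.induce S).Reachable ⟨Sum.inr x, hx⟩ ⟨Sum.inr y, hy⟩ := fun x y hx hy =>
      ((hconn₂ v ((hU₂ v).2 ⟨x, hx⟩)).preconnected ⟨x, hx⟩ ⟨y, hy⟩).map f₂
    have c : ∀ x y (hx : v ∈ β₁ x) (hy : v ∈ β₂ y),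
        (T.induce S).Reachable ⟨Sum.inl x, hx⟩ ⟨Sum.inr y, hy⟩ := fun x y hx hy => by
      obtain ⟨hv₁, hv₂⟩ := h v ((hU₁ v).2 ⟨x, hx⟩) ((hU₂ v).2 ⟨y, hy⟩)
      rw [← hr₁] at hv₁
      rw [← hr₂] at hv₂
      refine (c₁ x r₁ hx hv₁).trans (.trans (SimpleGraph.Adj.reachable ?_) (c₂ r₂ y hv₂ hy))
      exact Or.inr (by simp [SimpleGraph.edge])
    have hne : Nonempty S := by
      rcases Finset.mem_union.1 hv with hv | hv
      · obtain ⟨t, ht⟩ := (hU₁ v).1 hv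
        exact ⟨⟨Sum.inl t, ht⟩⟩
      · obtain ⟨t, ht⟩ := (hU₂ v).1 hv
        exact ⟨⟨Sum.inr t, ht⟩⟩
    refine ⟨?_⟩
    rintro ⟨x | x, hx⟩ ⟨y | y, hy⟩
    · exact c₁ x y hx hy
    · exact c x y hx hy
    · exact (c y x hy hx).symm
    · exact c₂ x y hx hy
  · rintro (t | t)
    exacts [hb₁ t, hb₂ t]

omit [DecidableEq V] in
theorem HasRootedTD.mono {b : ℕ} {C C' : Set (Finset V)} {U R : Finset V}
    (h : HasRootedTD b C U R) (hC : ∀ c ∈ C', ∃ c' ∈ C, c ⊆ c') : HasRootedTD b C' U R := by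
  obtain ⟨ι, T, β, r, hT, hr, hU, hCβ, hrest⟩ := h
  refine ⟨ι, T, β, r, hT, hr, hU, fun c hc => ?_, hrest⟩
  obtain ⟨c', hc', hle⟩ := hC c hc
  obtain ⟨t, ht⟩ := hCβ c' hc'
  exact ⟨t, hle.trans ht⟩

end RootedTD

section Border

variable {E : Type*} [Fintype E] [DecidableEq E]

/-- The number of vertices incident with both a hyperedge in `X` and one outside `X`. -/
def borderCard (ends : E → Finset V) (X : Finset E) : ℕ :=
  (X.biUnion ends ∩ Xᶜ.biUnion ends).card

omit [Fintype V] in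
theorem isConnectivityFun_borderCard (ends : E → Finset V) :
    IsConnectivityFun (borderCard ends) := by
  refine ⟨fun X => ?_, fun X Y => ?_⟩
  · simp only [borderCard, compl_compl]
    rw [Finset.inter_comm]
  · have hcard : ∀ X : Finset E, borderCard ends X + (Finset.univ.biUnion ends).card =
        (X.biUnion ends).card + (Xᶜ.biUnion ends).card := fun X => by
      have := Finset.card_union_add_card_inter (X.biUnion ends) (Xᶜ.biUnion ends)
      rw [← Finset.union_biUnion, Finset.union_compl] at this
      unfold borderCard
      omega
    have hsub : ∀ X Y : Finset E, ((X ∩ Y).biUnion ends).card + ((X ∪ Y).biUnion ends).card ≤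
        (X.biUnion ends).card + (Y.biUnion ends).card := fun X Y => by
      rw [← Finset.card_inter_add_card_union (X.biUnion ends), Finset.union_biUnion]
      refine Nat.add_le_add_right (Finset.card_le_card ?_) _
      exact Finset.subset_inter (Finset.biUnion_subset_biUnion_of_subset_left _
        Finset.inter_subset_left) (Finset.biUnion_subset_biUnion_of_subset_left _
        Finset.inter_subset_right)
    have h1 := hsub X Y
    have h2 := hsub Xᶜ Yᶜ
    rw [← Finset.compl_union, ← Finset.compl_inter] at h2
    have h3 := hcard X
    have h4 := hcard Y
    have h5 := hcard (X ∩ Y)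
    have h6 := hcard (X ∪ Y)
    omega

omit [Fintype V] in
/-- A branch decomposition of width at most `k` yields a tree decomposition with bags of size
at most `3 * k / 2`. -/
theorem DisjUnionGen.exists_hasRootedTD {ends : E → Finset V} {k b : ℕ}
    (hb : 3 * k ≤ 2 * b + 1) (hends : ∀ e, (ends e).card ≤ b) {X : Finset E}
    (h : DisjUnionGen (borderCard ends) (k + 1) {X | X.card ≤ 1 ∧ borderCard ends X < k + 1} X) :
    ∃ R, X.biUnion ends ∩ Xᶜ.biUnion ends ⊆ R ∧
      HasRootedTD b (ends '' X) (X.biUnion ends) R := by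
  induction h with
  | @base X h =>
    rcases Nat.le_one_iff_eq_zero_or_eq_one.1 h.1 with h | h
    · obtain rfl := Finset.card_eq_zero.1 h
      exact ⟨∅, by simp, (HasRootedTD.single (by simp)).mono (by simp)⟩
    · obtain ⟨e, rfl⟩ := Finset.card_eq_one.1 h
      refine ⟨ends e, by simp, ?_⟩
      simpa using HasRootedTD.single (hends e)
  | @union Y Z hY hZ hd hlt ihY ihZ =>
    obtain ⟨RY, hRY, tY⟩ := ihY
    obtain ⟨RZ, hRZ, tZ⟩ := ihZ
    have hYlt := hY.lt fun X hX => hX.2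
    have hZlt := hZ.lt fun X hX => hX.2
    have hYc : Yᶜ = Z ∪ (Y ∪ Z)ᶜ := by
      ext e
      have := fun h : e ∈ Y => Finset.disjoint_left.1 hd h
      simp only [Finset.mem_compl, Finset.mem_union]
      tauto
    have hZc : Zᶜ = Y ∪ (Y ∪ Z)ᶜ := by
      ext e
      have := fun h : e ∈ Y => Finset.disjoint_left.1 hd h
      simp only [Finset.mem_compl, Finset.mem_union]
      tauto
    unfold borderCard at hlt hYlt hZlt
    rw [hYc, Finset.union_biUnion] at hYlt hRY
    rw [hZc, Finset.union_biUnion] at hZlt hRZ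
    rw [Finset.union_biUnion] at hlt ⊢
    generalize Y.biUnion ends = VY at *
    generalize Z.biUnion ends = VZ at *
    generalize (Y ∪ Z)ᶜ.biUnion ends = VX at *
    let R : Finset V := (VY ∪ VZ) ∩ VX ∪ VY ∩ VZ
    have hR : R.card ≤ b := by
      have h1 : R.card + R.card ≤ ((VY ∪ VZ) ∩ VX).card + (VY ∩ (VZ ∪ VX)).card +
          (VZ ∩ (VY ∪ VX)).card := by
        have i1 : R.card ≤ ((VY ∪ VZ) ∩ VX).card + ((VY ∩ VZ) \ VX).card := by
          refine (Finset.card_le_card fun v => ?_).trans (Finset.card_union_le _ _)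
          simp only [R, Finset.mem_union, Finset.mem_inter, Finset.mem_sdiff]
          tauto
        have i2 : R.card + (VY ∩ VZ).card ≤ (VY ∩ (VZ ∪ VX)).card + (VZ ∩ (VY ∪ VX)).card := by
          rw [← Finset.card_union_add_card_inter (VY ∩ (VZ ∪ VX))]
          refine Nat.add_le_add (Finset.card_le_card fun v => ?_)
            (Finset.card_le_card fun v => ?_)
          all_goals
            simp only [R, Finset.mem_union, Finset.mem_inter]
            tauto
        have i3 : ((VY ∩ VZ) \ VX).card ≤ (VY ∩ VZ).card :=
          Finset.card_le_card fun v => by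
            simp only [Finset.mem_inter, Finset.mem_sdiff]
            tauto
        omega
      omega
    refine ⟨R, Finset.subset_union_left, ?_⟩
    have hRU : R ∪ VY ∪ VZ = VY ∪ VZ := by
      ext v
      simp only [R, Finset.mem_union, Finset.mem_inter]
      tauto
    rw [← hRU]
    refine (((HasRootedTD.single hR).join tY ?_).join tZ ?_).mono ?_
    · intro v hv hvY
      refine ⟨hv, hRY ?_⟩
      simp only [R, Finset.mem_union, Finset.mem_inter] at hv ⊢
      tauto
    · intro v hv hvZ
      have : v ∈ R := by
        simp only [R, Finset.mem_union, Finset.mem_inter] at hv ⊢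
        tauto
      refine ⟨this, hRZ ?_⟩
      simp only [R, Finset.mem_union, Finset.mem_inter] at this ⊢
      tauto
    · rintro _ ⟨e, he, rfl⟩
      refine ⟨ends e, ?_, subset_rfl⟩
      rcases Finset.mem_union.1 he with he | he
      exacts [Or.inl (Or.inr ⟨e, he, rfl⟩), Or.inr ⟨e, he, rfl⟩]

end Border

section Incidence

variable (G : SimpleGraph V)

/-- The ordered pairs of equal or adjacent vertices of `G`. -/
abbrev ClosedDart : Type u := {p : V × V // p.1 = p.2 ∨ G.Adj p.1 p.2}

noncomputable instance : Fintype (ClosedDart G) := Fintype.ofFinite _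

variable {G}

/-- The set of endpoints of a pair of equal or adjacent vertices. -/
def ClosedDart.ends (e : ClosedDart G) : Finset V := {e.1.1, e.1.2}

omit [Fintype V] in
theorem ClosedDart.card_ends_le (e : ClosedDart G) : e.ends.card ≤ 2 := Finset.card_le_two

open Classical in
/-- The pairs of equal or adjacent vertices of a subgraph. -/
noncomputable def closedDarts (A : G.Subgraph) : Finset (ClosedDart G) :=
  {e | e.1.1 = e.1.2 ∧ e.1.1 ∈ A.verts ∨ A.Adj e.1.1 e.1.2}

theorem mem_closedDarts {A : G.Subgraph} {e : ClosedDart G} :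
    e ∈ closedDarts A ↔ e.1.1 = e.1.2 ∧ e.1.1 ∈ A.verts ∨ A.Adj e.1.1 e.1.2 := by
  simp [closedDarts]

theorem closedDarts_sup (A B : G.Subgraph) :
    closedDarts (A ⊔ B) = closedDarts A ∪ closedDarts B := by
  ext e
  simp only [mem_closedDarts, Finset.mem_union, SimpleGraph.Subgraph.verts_sup, Set.mem_union,
    SimpleGraph.Subgraph.sup_adj]
  tauto

theorem closedDarts_top : closedDarts (⊤ : G.Subgraph) = Finset.univ := by
  ext e
  simpa [mem_closedDarts] using e.2

theorem ends_subset_verts {A : G.Subgraph} {e : ClosedDart G} (he : e ∈ closedDarts A) :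
    ↑e.ends ⊆ A.verts := by
  intro v hv
  simp only [ClosedDart.ends, Finset.coe_insert, Finset.coe_singleton, Set.mem_insert_iff,
    Set.mem_singleton_iff] at hv
  rcases mem_closedDarts.1 he with ⟨h, h'⟩ | h
  · rw [← h] at hv
    rcases hv with rfl | rfl <;> exact h'
  · rcases hv with rfl | rfl
    exacts [A.edge_vert h, A.edge_vert h.symm]

theorem biUnion_ends_closedDarts_subset (A : G.Subgraph) :
    ↑((closedDarts A).biUnion ClosedDart.ends) ⊆ A.verts := by
  intro v hv
  obtain ⟨e, he, hv⟩ := Finset.mem_biUnion.1 (Finset.mem_coe.1 hv)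
  exact ends_subset_verts he hv

theorem IsGSep.compl_closedDarts_subset {A B : G.Subgraph} (h : IsGSep G A B) :
    (closedDarts A)ᶜ ⊆ closedDarts B := by
  intro e he
  have : e ∈ closedDarts (A ⊔ B) := by rw [h.1, closedDarts_top]; exact Finset.mem_univ e
  rw [closedDarts_sup, Finset.mem_union] at this
  exact this.resolve_left (Finset.mem_compl.1 he)

theorem IsGSep.borderCard_closedDarts_le {A B : G.Subgraph} (h : IsGSep G A B) :
    borderCard ClosedDart.ends (closedDarts A) ≤ (A.verts ∩ B.verts).ncard := by
  rw [borderCard, ← Set.ncard_coe_finset, Finset.coe_inter]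
  refine Set.ncard_le_ncard (Set.inter_subset_inter (biUnion_ends_closedDarts_subset A) ?_)
    (Set.toFinite _)
  exact (Finset.coe_subset.2 (Finset.biUnion_subset_biUnion_of_subset_left _
    h.compl_closedDarts_subset)).trans (biUnion_ends_closedDarts_subset B)

omit [Fintype V] [DecidableEq V] in
theorem IsGSep.symm {A B : G.Subgraph} (h : IsGSep G A B) : IsGSep G B A :=
  ⟨sup_comm A B ▸ h.1, Set.inter_comm _ _ ▸ h.2⟩

theorem exists_isTangle_of_not_disjUnionGen {θ : ℕ} (hθ : 3 ≤ θ)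
    (h : ¬DisjUnionGen (borderCard (ClosedDart.ends (G := G))) θ
      {X | X.card ≤ 1 ∧ borderCard ClosedDart.ends X < θ} Finset.univ) :
    ∃ T, IsTangle G T θ := by
  have hf := isConnectivityFun_borderCard (ClosedDart.ends (G := G))
  have hempty₀ : ∅ ∈ {X : Finset (ClosedDart G) |
      X.card ≤ 1 ∧ borderCard ClosedDart.ends X < θ} := by
    simp [borderCard]
    omega
  obtain ⟨N, hN₀, hN, hdown, huniv, hor⟩ := hf.exists_orientation
    (N₀ := {X | X.card ≤ 1 ∧ borderCard ClosedDart.ends X < θ}) (fun X hX => hX.2)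
    (fun X hX Y hYX hY => ⟨(Finset.card_le_card hYX).trans hX.1, hY⟩) hempty₀ h
  have hempty : ∅ ∈ N := hN₀ hempty₀
  have hborder : ∀ X : Finset (ClosedDart G),
      borderCard ClosedDart.ends X ≤ (X.biUnion ClosedDart.ends).card := fun X =>
    Finset.card_le_card Finset.inter_subset_left
  have hgen : ∀ X : Finset (ClosedDart G), (X.biUnion ClosedDart.ends).card < θ →
      DisjUnionGen (borderCard ClosedDart.ends) θ N X := by
    intro X
    induction X using Finset.induction_on with
    | empty => exact fun _ => .base hempty
    | insert e X he ih =>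
      intro hX
      have hle : (X.biUnion ClosedDart.ends).card < θ := (Finset.card_le_card
        (Finset.biUnion_subset_biUnion_of_subset_left _ (Finset.subset_insert e X))).trans_lt hX
      have he' : {e} ∈ N := by
        refine hN₀ ⟨by simp, (hborder _).trans_lt ?_⟩
        rw [Finset.singleton_biUnion]
        have := e.card_ends_le
        omega
      rw [Finset.insert_eq] at hX ⊢
      exact .union (.base he') (ih hle) (by simpa using he) ((hborder _).trans_lt hX)
  have hsmall : ∀ X : Finset (ClosedDart G), (X.biUnion ClosedDart.ends).card < θ → X ∈ N := by
    intro X hX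
    refine (hor X ((hborder X).trans_lt hX)).resolve_right fun hXc => huniv ?_
    have := DisjUnionGen.union (hgen X hX) (.base hXc) disjoint_compl_right (by
      rw [Finset.union_compl]; simp [borderCard]; omega)
    rwa [Finset.union_compl] at this
  have hcover {A B C} (hA : A ∈ N) (hB : B ∈ N) (hC : C ∈ N) : A ∪ B ∪ C ≠ Finset.univ :=
    hf.union_ne_univ hN hdown hempty huniv hA hB hC
  have hcard : ∀ (X : Finset (ClosedDart G)) (S : Set V), S.ncard < θ →
      (∀ e ∈ X, ↑e.ends ⊆ S) → X ∈ N := by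
    intro X S hS hX
    refine hsmall X (lt_of_le_of_lt ?_ hS)
    rw [← Set.ncard_coe_finset]
    refine Set.ncard_le_ncard (fun v hv => ?_) (Set.toFinite _)
    obtain ⟨e, he, hv⟩ := Finset.mem_biUnion.1 (Finset.mem_coe.1 hv)
    exact hX e he hv
  refine ⟨{p | IsGSep G p.1 p.2 ∧ (p.1.verts ∩ p.2.verts).ncard < θ ∧ closedDarts p.1 ∈ N},
    by omega, fun p hp => hp.1, ?_, ?_, ?_⟩
  · intro A B hAB hlt
    by_contra! hnot
    have hA : closedDarts A ∉ N := fun hA => hnot.1 ⟨hAB, hlt, hA⟩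
    have hlt' : (B.verts ∩ A.verts).ncard < θ := by rwa [Set.inter_comm]
    have hB : closedDarts B ∉ N := fun hB => hnot.2 ⟨hAB.symm, hlt', hB⟩
    have hA' := (hor _ (hAB.borderCard_closedDarts_le.trans_lt hlt)).resolve_left hA
    have hB' := (hor _ (hAB.symm.borderCard_closedDarts_le.trans_lt hlt')).resolve_left hB
    refine hcover hA' hB' (hcard (closedDarts A ∩ closedDarts B) _ hlt fun e he => ?_) ?_
    · exact Set.subset_inter (ends_subset_verts (Finset.mem_inter.1 he).1)
        (ends_subset_verts (Finset.mem_inter.1 he).2)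
    · rw [← Finset.compl_inter, Finset.union_comm, Finset.union_compl]
  · rintro p₁ ⟨-, -, h₁⟩ p₂ ⟨-, -, h₂⟩ p₃ ⟨-, -, h₃⟩ htop
    refine hcover h₁ h₂ h₃ ?_
    rw [← closedDarts_sup, ← closedDarts_sup, htop, closedDarts_top]
  · rintro ⟨A, B⟩ ⟨hAB, hlt, hA⟩ hV
    simp only at hAB hlt hA hV
    rw [hV, Set.univ_inter] at hlt
    have hB : closedDarts B ∈ N := hcard _ _ hlt fun e he => ends_subset_verts he
    refine hcover hA hB hB ?_
    rw [← closedDarts_sup, hAB.1, closedDarts_top]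
    simp

end Incidence

omit [DecidableEq V] in
theorem IsTangle.le_card {G : SimpleGraph V} {T : Set (G.Subgraph × G.Subgraph)} {θ : ℕ}
    (hT : IsTangle G T θ) : θ ≤ Fintype.card V := by
  by_contra! hlt
  obtain ⟨-, -, hor, -, hspan⟩ := hT
  let B : G.Subgraph :=
    { verts := Set.univ, Adj := fun _ _ => False, adj_sub := False.elim, edge_vert := False.elim }
  have hsep : IsGSep G ⊤ B := by
    refine ⟨top_sup_eq B, ?_⟩
    have : B.edgeSet = ∅ := by
      ext e
      induction e
      simp [B]
    rw [this, Set.inter_empty]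
  rcases hor ⊤ B hsep (by simpa [B, Set.ncard_univ] using hlt) with h | h
  exacts [hspan _ h rfl, hspan _ h rfl]

omit [DecidableEq V] in
theorem bddAbove_isTangle (G : SimpleGraph V) : BddAbove {θ | ∃ T, IsTangle G T θ} :=
  ⟨Fintype.card V, fun _ ⟨_, hT⟩ => hT.le_card⟩

theorem hasTDWidthLE_of_hasRootedTD {G : SimpleGraph V} {w : ℕ} {R : Finset V}
    (h : HasRootedTD (w + 1)
      (ClosedDart.ends '' ((Finset.univ : Finset (ClosedDart G)) : Set (ClosedDart G)))
      (Finset.univ.biUnion (ClosedDart.ends (G := G))) R) : HasTDWidthLE G w := by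
  obtain ⟨ι, T, β, r, hT, -, hU, hC, hconn, hb⟩ := h
  have hC' : ∀ e : ClosedDart G, ∃ t, e.ends ⊆ β t := fun e => hC _ ⟨e, by simp, rfl⟩
  have hU' : ∀ v, v ∈ Finset.univ.biUnion (ClosedDart.ends (G := G)) := fun v =>
    Finset.mem_biUnion.2 ⟨⟨(v, v), .inl rfl⟩, Finset.mem_univ _, by simp [ClosedDart.ends]⟩
  refine ⟨ι, T, β, hT, fun v => (hU v).1 (hU' v), fun u v huv => ?_, fun v => hconn v (hU' v), hb⟩
  obtain ⟨t, ht⟩ := hC' ⟨(u, v), .inr huv⟩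
  exact ⟨t, ht (by simp [ClosedDart.ends]), ht (by simp [ClosedDart.ends])⟩

/-- Robertson–Seymour: if `tn(G) ≥ 2` then `tn(G) ≤ tw(G) + 1 ≤ (3/2) tn(G)`. -/
theorem tangleNum_le_treewidth_add_one (G : SimpleGraph V) (h : 2 ≤ tangleNum G) :
    tangleNum G ≤ treewidth G + 1 ∧ 2 * (treewidth G + 1) ≤ 3 * tangleNum G := by
  have hgen : DisjUnionGen (borderCard (ClosedDart.ends (G := G))) (tangleNum G + 1)
      {X | X.card ≤ 1 ∧ borderCard ClosedDart.ends X < tangleNum G + 1} Finset.univ := by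
    by_contra hnot
    have : tangleNum G + 1 ≤ tangleNum G := le_csSup (bddAbove_isTangle G)
      (exists_isTangle_of_not_disjUnionGen (by omega) hnot)
    omega
  obtain ⟨w, hw⟩ : ∃ w, 3 * tangleNum G / 2 = w + 1 := ⟨3 * tangleNum G / 2 - 1, by omega⟩
  obtain ⟨R, -, hR⟩ := hgen.exists_hasRootedTD (b := w + 1) (by omega)
    fun e => e.card_ends_le.trans (by omega)
  have hwidth : HasTDWidthLE G w := hasTDWidthLE_of_hasRootedTD hR
  constructor
  · obtain ⟨T, hT⟩ : ∃ T, IsTangle G T (tangleNum G) := by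
      refine Nat.sSup_mem (s := {θ | ∃ T, IsTangle G T θ}) ?_ (bddAbove_isTangle G)
      by_contra! hempty
      rw [tangleNum, hempty] at h
      simp at h
    exact hT.le_of_hasTDWidthLE
      (Nat.sInf_mem (s := {w | HasTDWidthLE G w}) ⟨w, hwidth⟩)
  · have : treewidth G ≤ w := Nat.sInf_le hwidth
    omega
end

section
/- Let G be a finite directed graph with a set S of sinks and a demand function d : V(G) → ℝ₊, and suppose there exists a flow in G with demand function d and congestion at most c. Then there exists a confluent flow in G with congestion at most c and demand function d' such that d'(v) ≤ d(v) for every vertex v, and the total demand satisfies d'(V(G)) ≥ d(V(G))/3. -/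
open Finset

variable {V : Type*} [Fintype V] [DecidableEq V]

/-- `f` is a flow on the digraph with edge relation `E`, sink set `S` and demand
function `d`: it is nonnegative, supported on edges, and satisfies the conservation
equation at every vertex outside `S`. -/
def IsFlow (E : V → V → Prop) (S : Set V) (d : V → ℝ) (f : V → V → ℝ) : Prop :=
  (∀ u v, 0 ≤ f u v) ∧ (∀ u v, ¬ E u v → f u v = 0) ∧
    ∀ v ∉ S, (∑ w, f v w) - (∑ u, f u v) = d v

/-- `f` is confluent: there is no directed cycle all of whose edges have positive
flow value, and every vertex has at most one outgoing edge with positive flow value. -/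
def IsConfluent (f : V → V → ℝ) : Prop :=
  (¬ ∃ (n : ℕ) (hn : 0 < n) (c : Fin n → V),
      Function.Injective c ∧
        ∀ i : Fin n, 0 < f (c i) (c ⟨(i + 1) % n, Nat.mod_lt _ hn⟩)) ∧
    ∀ v w₁ w₂, 0 < f v w₁ → 0 < f v w₂ → w₁ = w₂

/-- A nonnegative flow out of the complement of `D`, with vertex capacity `c`, in which each
vertex outside `D` forwards at most what it receives plus its demand. -/
def LeakyFlow (D : Finset V) (d : V → ℝ) (c : ℝ) (F : V → V → ℝ) : Prop :=
  (∀ u v, 0 ≤ F u v) ∧ (∀ u ∈ D, ∀ v, F u v = 0) ∧ (∀ u, ∑ w, F u w ≤ c) ∧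
    ∀ u ∉ D, ∑ w, F u w ≤ ∑ x, F x u + d u

/-- A leaky flow whose support cannot be shrunk while keeping the inflow into `D`. -/
def ReducedFlow (D : Finset V) (d : V → ℝ) (c : ℝ) (F : V → V → ℝ) : Prop :=
  LeakyFlow D d c F ∧ ∀ G, LeakyFlow D d c G → (∀ u v, F u v = 0 → G u v = 0) →
    (∀ t ∈ D, ∑ u, G u t = ∑ u, F u t) → ∀ u v, G u v = 0 → F u v = 0

set_option linter.unusedSectionVars false in
lemma LeakyFlow.exists_reduced {D : Finset V} {d : V → ℝ} {c : ℝ} {F : V → V → ℝ}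
    (hF : LeakyFlow D d c F) :
    ∃ G, ReducedFlow D d c G ∧ (∀ u v, F u v = 0 → G u v = 0) ∧
      ∀ t ∈ D, ∑ u, G u t = ∑ u, F u t := by
  classical
  let s : (V → V → ℝ) → Finset (V × V) := fun G => univ.filter fun p => G p.1 p.2 ≠ 0
  let A : Set (V → V → ℝ) := {G | LeakyFlow D d c G ∧ (∀ u v, F u v = 0 → G u v = 0) ∧
    ∀ t ∈ D, ∑ u, G u t = ∑ u, F u t}
  obtain ⟨G, ⟨hG1, hG2, hG3⟩, hmin⟩ :=
    (measure fun G => #(s G)).wf.has_min A ⟨F, hF, fun _ _ h => h, fun _ _ => rfl⟩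
  refine ⟨G, ⟨hG1, fun H hH hsub hin u v hz => ?_⟩, hG2, hG3⟩
  have hle : #(s G) ≤ #(s H) := not_lt.mp
    (hmin H ⟨hH, fun u v h => hsub u v (hG2 u v h), fun t ht => (hin t ht).trans (hG3 t ht)⟩)
  have hss : s H ⊆ s G := by
    intro p hp
    simp only [s, mem_filter, mem_univ, true_and] at hp ⊢
    exact fun h => hp (hsub _ _ h)
  have heq := eq_of_subset_of_card_le hss hle
  by_contra hne
  have : (u, v) ∈ s H := by rw [heq]; simpa [s] using hne
  simp [s, hz] at this

set_option linter.unusedSectionVars false in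
/-- A divergence-free direction inside the support that increases no outflow is trivial. -/
lemma ReducedFlow.eq_zero {D : Finset V} {d : V → ℝ} {c : ℝ} {F : V → V → ℝ}
    (hF : ReducedFlow D d c F) {h : V → V → ℝ} (hs : ∀ u v, F u v = 0 → h u v = 0)
    (hout : ∀ u, ∑ w, h u w ≤ 0) (hdiv : ∀ u, ∑ w, h u w - ∑ x, h x u = 0) :
    ∀ u v, h u v = 0 := by
  classical
  by_contra! hne
  obtain ⟨⟨hF0, hFD, hFc, hFl⟩, hmin⟩ := hF
  let N : Finset (V × V) := univ.filter fun p => h p.1 p.2 < 0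
  have hN : N.Nonempty := by
    by_contra hN
    have hpos : ∀ u v, 0 ≤ h u v := fun u v => by
      by_contra hlt
      exact hN ⟨(u, v), by simpa [N] using hlt⟩
    obtain ⟨u, v, huv⟩ := hne
    have h0 : ∑ w, h u w = 0 := le_antisymm (hout u) (sum_nonneg fun w _ => hpos u w)
    exact huv ((sum_eq_zero_iff_of_nonneg fun w _ => hpos u w).mp h0 v (mem_univ v))
  obtain ⟨p, hpN, hp⟩ := exists_min_image N (fun p => F p.1 p.2 / (-h p.1 p.2)) hN
  have hp0 : h p.1 p.2 < 0 := by simpa [N] using hpN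
  set ε := F p.1 p.2 / (-h p.1 p.2) with hε
  have hε0 : 0 ≤ ε := div_nonneg (hF0 _ _) (by linarith)
  have hsumo : ∀ u, ∑ w, (F u w + ε * h u w) = ∑ w, F u w + ε * ∑ w, h u w := fun u => by
    rw [sum_add_distrib, mul_sum]
  have hsumi : ∀ u, ∑ x, (F x u + ε * h x u) = ∑ x, F x u + ε * ∑ x, h x u := fun u => by
    rw [sum_add_distrib, mul_sum]
  have key := hmin (fun u v => F u v + ε * h u v) ⟨?_, ?_, ?_, ?_⟩ ?_ ?_ p.1 p.2 ?_
  · exact hp0.ne (hs _ _ key)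
  · intro u v
    rcases le_or_gt 0 (h u v) with h0 | h0
    · have := hF0 u v
      positivity
    · have := hp (u, v) (by simpa [N] using h0)
      rw [le_div_iff₀ (by simpa using h0)] at this
      simp only at this
      linarith
  · intro u hu v
    simp [hFD u hu v, hs u v (hFD u hu v)]
  · intro u
    rw [hsumo]
    nlinarith [hFc u, hout u]
  · intro u hu
    rw [hsumo, hsumi]
    have : ∑ w, h u w = ∑ x, h x u := by linarith [hdiv u]
    rw [this]
    linarith [hFl u hu]
  · intro u v huv
    simp [huv, hs u v huv]
  · intro t ht
    have h0 : ∑ w, h t w = 0 := sum_eq_zero fun w _ => hs t w (hFD t ht w)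
    have : ∑ x, h x t = 0 := by linarith [hdiv t]
    simp only [hsumi, this, mul_zero, add_zero]
  · have : h p.1 p.2 ≠ 0 := hp0.ne
    simp only [hε]
    field_simp
    ring

/-- The unit flow along a nonempty path. -/
lemma exists_path_flow {F : V → V → ℝ} {a b : V}
    (hab : Relation.TransGen (fun x y => F x y ≠ 0) a b) :
    ∃ P : V → V → ℝ, (∀ u v, 0 ≤ P u v) ∧ (∀ u v, F u v = 0 → P u v = 0) ∧
      0 < ∑ w, P a w ∧
      ∀ u, ∑ w, P u w - ∑ x, P x u = (if u = a then 1 else 0) - (if u = b then 1 else 0) := by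
  have edge : ∀ x y : V, F x y ≠ 0 → ∃ P : V → V → ℝ, (∀ u v, 0 ≤ P u v) ∧
      (∀ u v, F u v = 0 → P u v = 0) ∧ 0 < ∑ w, P x w ∧
      ∀ u, ∑ w, P u w - ∑ z, P z u = (if u = x then 1 else 0) - (if u = y then 1 else 0) := by
    intro x y hxy
    refine ⟨fun u v => if u = x then (if v = y then 1 else 0) else 0, ?_, ?_, ?_, ?_⟩
    · intro u v
      dsimp only
      split_ifs <;> norm_num
    · intro u v huv
      dsimp only
      split_ifs with h1 h2
      · subst h1 h2; exact absurd huv hxy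
      · rfl
      · rfl
    · simp
    · intro u
      by_cases hu : u = x <;> simp [hu]
  induction hab with
  | single h => exact edge _ _ h
  | @tail y z _ hyz ih =>
    obtain ⟨P, hP0, hPs, hPa, hPd⟩ := ih
    obtain ⟨Q, hQ0, hQs, -, hQd⟩ := edge y z hyz
    refine ⟨fun u v => P u v + Q u v, fun u v => add_nonneg (hP0 u v) (hQ0 u v),
      fun u v h => by simp [hPs u v h, hQs u v h], ?_, fun u => ?_⟩
    · rw [sum_add_distrib]
      have : 0 ≤ ∑ w, Q a w := sum_nonneg fun w _ => hQ0 a w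
      linarith
    · simp only [sum_add_distrib]
      linarith [hPd u, hQd u]

lemma ReducedFlow.acyclic {D : Finset V} {d : V → ℝ} {c : ℝ} {F : V → V → ℝ}
    (hF : ReducedFlow D d c F) (x : V) : ¬ Relation.TransGen (fun x y => F x y ≠ 0) x x := by
  intro hx
  obtain ⟨P, hP0, hPs, hPa, hPd⟩ := exists_path_flow hx
  have h0 := hF.eq_zero (h := fun u v => - P u v) (fun u v h => by simp [hPs u v h])
    (fun u => by simpa using sum_nonneg fun w _ => hP0 u w)
    (fun u => by simp only [sum_neg_distrib]; linarith [hPd u])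
  have : ∑ w, P x w = 0 := sum_eq_zero fun w _ => by simpa using h0 x w
  linarith

lemma ReducedFlow.exists_out {D : Finset V} {d : V → ℝ} {c : ℝ} {F : V → V → ℝ}
    (hd : ∀ v, 0 ≤ d v) (hF : ReducedFlow D d c F) {u x : V} (hx : x ∉ D) (hux : F u x ≠ 0) :
    ∃ y, F x y ≠ 0 := by
  by_contra! h0
  obtain ⟨⟨hF0, hFD, hFc, hFl⟩, hmin⟩ := hF
  have hle : ∀ a, ∑ w, (if w = x then 0 else F a w) ≤ ∑ w, F a w := fun a =>
    sum_le_sum fun w _ => by split_ifs <;> simp [hF0]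
  refine hux (hmin (fun a b => if b = x then 0 else F a b) ⟨?_, ?_, ?_, ?_⟩ ?_ ?_ u x (by simp))
  · intro a b
    dsimp only
    split_ifs <;> simp [hF0]
  · intro a ha b
    simp [hFD a ha b]
  · exact fun a => (hle a).trans (hFc a)
  · intro a ha
    by_cases hax : a = x
    · subst hax
      simpa [h0] using hd a
    · simpa [hax] using (hle a).trans (hFl a ha)
  · intro a b hab
    simp [hab]
  · intro t ht
    have : t ≠ x := fun h => hx (h ▸ ht)
    simp [this]

lemma ReducedFlow.exists_path {D : Finset V} {d : V → ℝ} {c : ℝ} {F : V → V → ℝ}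
    (hd : ∀ v, 0 ≤ d v) (hF : ReducedFlow D d c F) {u x : V} (hx : x ∉ D) (hux : F u x ≠ 0) :
    ∃ t ∈ D, Relation.TransGen (fun x y => F x y ≠ 0) x t := by
  let r : V → V → Prop := fun b a => Relation.TransGen (fun x y => F x y ≠ 0) a b
  have : IsTrans V r := ⟨fun _ _ _ h1 h2 => h2.trans h1⟩
  have : Std.Irrefl r := ⟨hF.acyclic⟩
  have wf : WellFounded r := Finite.wellFounded_of_trans_of_irrefl r
  induction x using wf.induction generalizing u with
  | _ x ih =>
    obtain ⟨y, hy⟩ := hF.exists_out hd hx hux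
    by_cases hyD : y ∈ D
    · exact ⟨y, hyD, .single hy⟩
    · obtain ⟨t, ht, hyt⟩ := ih y (.single hy) hyD hy
      exact ⟨t, ht, .head hy hyt⟩

/-- Inflow can be moved from `t'` to `t` within the support of `F` without increasing any
outflow. -/
def Exchange (F : V → V → ℝ) (t t' : V) (h : V → V → ℝ) : Prop :=
  (∀ u v, F u v = 0 → h u v = 0) ∧ (∀ u, ∑ w, h u w ≤ 0) ∧
    ∀ u, ∑ w, h u w - ∑ x, h x u = (if u = t' then 1 else 0) - (if u = t then 1 else 0)

lemma Exchange.add {F : V → V → ℝ} {r s t : V} {h k : V → V → ℝ}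
    (h1 : Exchange F r s h) (h2 : Exchange F s t k) :
    Exchange F r t fun u v => h u v + k u v := by
  obtain ⟨a1, a2, a3⟩ := h1
  obtain ⟨b1, b2, b3⟩ := h2
  refine ⟨fun u v huv => by simp [a1 u v huv, b1 u v huv], fun u => ?_, fun u => ?_⟩
  · rw [sum_add_distrib]
    linarith [a2 u, b2 u]
  · simp only [sum_add_distrib]
    linarith [a3 u, b3 u]

/-- An exchange that strictly decreases some outflow. -/
def StrictExchange (F : V → V → ℝ) (t t' : V) : Prop :=
  ∃ h, Exchange F t t' h ∧ ∃ x, ∑ w, h x w < 0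

lemma Exchange.trans_strict {F : V → V → ℝ} {r s t : V} {h : V → V → ℝ}
    (h1 : Exchange F r s h) (h2 : StrictExchange F s t) : StrictExchange F r t := by
  obtain ⟨k, hk, x, hx⟩ := h2
  refine ⟨_, h1.add hk, x, ?_⟩
  rw [sum_add_distrib]
  linarith [h1.2.1 x]

lemma ReducedFlow.not_strictExchange {D : Finset V} {d : V → ℝ} {c : ℝ} {F : V → V → ℝ}
    (hF : ReducedFlow D d c F) (t : V) : ¬ StrictExchange F t t := by
  rintro ⟨h, ⟨h1, h2, h3⟩, x, hx⟩
  have := hF.eq_zero h1 h2 fun u => by rw [h3 u, sub_self]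
  simp [this] at hx

/-- The two ways to shift inflow between the heads of edges sharing a tail. -/
lemma exchange_of_common_tail {F : V → V → ℝ} {u t x : V} (ht : F u t ≠ 0) (hx : F u x ≠ 0) :
    ∃ h, Exchange F t x h := by
  refine ⟨fun a b => if a = u then (if b = t then 1 else 0) - (if b = x then 1 else 0) else 0,
    fun a b hab => ?_, fun a => ?_, fun a => ?_⟩
  · dsimp only
    split_ifs with h1 h2 h3 h3
    · simp
    · subst h1 h2; exact absurd hab ht
    · subst h1 h3; exact absurd hab hx
    · simp
    · rfl
  · by_cases ha : a = u <;> simp [ha]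
  · by_cases ha : a = u <;> simp [ha]

lemma ReducedFlow.exists_extremal {D : Finset V} {d : V → ℝ} {c : ℝ} {F : V → V → ℝ}
    (hd : ∀ v, 0 ≤ d v) (hF : ReducedFlow D d c F) (hin : ∃ t ∈ D, ∃ u, F u t ≠ 0) :
    ∃ M ⊆ D, M.Nonempty ∧ (∀ t ∈ M, ∃ u, F u t ≠ 0) ∧
      ∀ t ∈ M, ∀ u, F u t ≠ 0 → ∀ x, F u x ≠ 0 → x ∈ M := by
  classical
  let T : Finset V := D.filter fun t => ∃ u, F u t ≠ 0
  let r : V → V → Prop := fun b a => StrictExchange F a b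
  have : IsTrans V r := ⟨fun _ _ _ h1 h2 => by
    obtain ⟨k, hk, -⟩ := h2
    exact hk.trans_strict h1⟩
  have : Std.Irrefl r := ⟨hF.not_strictExchange⟩
  have wf : WellFounded r := Finite.wellFounded_of_trans_of_irrefl r
  obtain ⟨t₀, ht₀, u₀, hu₀⟩ := hin
  obtain ⟨m, hm, hmax⟩ := wf.has_min {t | t ∈ T} ⟨t₀, by simpa [T] using ⟨ht₀, u₀, hu₀⟩⟩
  let M : Finset V := T.filter fun t => ∀ t' ∈ T, ¬ StrictExchange F t t'
  have hMT : ∀ t ∈ M, t ∈ D ∧ ∃ u, F u t ≠ 0 := fun t ht => by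
    simpa [T] using (mem_filter.mp ht).1
  refine ⟨M, fun t ht => (hMT t ht).1, ⟨m, mem_filter.mpr ⟨hm, hmax⟩⟩,
    fun t ht => (hMT t ht).2, ?_⟩
  intro t ht u hut x hux
  obtain ⟨h, hh⟩ := exchange_of_common_tail hut hux
  have hxD : x ∈ D := by
    by_contra hxD
    obtain ⟨s, hs, hxs⟩ := hF.exists_path hd hxD hux
    obtain ⟨P, hP0, hPs, hPx, hPd⟩ := exists_path_flow hxs
    refine (mem_filter.mp ht).2 s ?_ (hh.trans_strict
      ⟨fun a b => -P a b, ⟨fun a b hab => by simp [hPs a b hab], fun a => ?_, fun a => ?_⟩, x, ?_⟩)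
    · obtain ⟨y, -, hy⟩ := Relation.TransGen.tail'_iff.mp hxs
      exact mem_filter.mpr ⟨hs, y, hy⟩
    · simpa using sum_nonneg fun w _ => hP0 a w
    · simp only [sum_neg_distrib]
      linarith [hPd a]
    · simpa using hPx
  refine mem_filter.mpr ⟨mem_filter.mpr ⟨hxD, u, hux⟩, fun s hs hst => ?_⟩
  exact (mem_filter.mp ht).2 s hs (hh.trans_strict hst)

/-- A vertex set pair in which all edges of `B` run from `W` to `M` and all degrees are at
least two carries a nonzero signed combination of edges with vanishing marginals. -/
lemma exists_balanced_of_two_le_degree (B : Finset (V × V))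
    (hB : B.Nonempty) (h1 : ∀ p ∈ B, ∃ q ∈ B, q.1 = p.1 ∧ q ≠ p)
    (h2 : ∀ p ∈ B, ∃ q ∈ B, q.2 = p.2 ∧ q ≠ p) :
    ∃ h : V → V → ℝ, (∃ u v, h u v ≠ 0) ∧ (∀ u v, (u, v) ∉ B → h u v = 0) ∧
      (∀ u, ∑ w, h u w = 0) ∧ ∀ v, ∑ u, h u v = 0 := by
  obtain ⟨p₀, hp₀⟩ := hB
  set W := B.image Prod.fst with hW
  set M := B.image Prod.snd with hM
  have card1 : 2 * #W ≤ #B := by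
    rw [card_eq_sum_card_image Prod.fst B, mul_comm, ← smul_eq_mul]
    refine card_nsmul_le_sum _ _ _ fun w hw => ?_
    obtain ⟨p, hp, rfl⟩ := mem_image.mp hw
    obtain ⟨q, hq, hqp, hne⟩ := h1 p hp
    exact one_lt_card.mpr ⟨q, by simp [hq, hqp], p, by simp [hp], hne⟩
  have card2 : 2 * #M ≤ #B := by
    rw [card_eq_sum_card_image Prod.snd B, mul_comm, ← smul_eq_mul]
    refine card_nsmul_le_sum _ _ _ fun w hw => ?_
    obtain ⟨p, hp, rfl⟩ := mem_image.mp hw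
    obtain ⟨q, hq, hqp, hne⟩ := h2 p hp
    exact one_lt_card.mpr ⟨q, by simp [hq, hqp], p, by simp [hp], hne⟩
  have hp₀M : p₀.2 ∈ M := mem_image_of_mem _ hp₀
  have card3 : #(M.erase p₀.2) < #M := card_erase_lt_of_mem hp₀M
  let A : Matrix (W ⊕ M.erase p₀.2) B ℝ := Matrix.of (Sum.elim
    (fun w e => if e.1.1 = w then 1 else 0) (fun t e => if e.1.2 = t then 1 else 0))
  have hker : LinearMap.ker A.mulVecLin ≠ ⊥ := by
    apply LinearMap.ker_ne_bot_of_finrank_lt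
    simp only [Module.finrank_fintype_fun_eq_card, Fintype.card_sum, Fintype.card_coe]
    omega
  obtain ⟨g, hg, hg0⟩ := (Submodule.ne_bot_iff _).mp hker
  have hgA : ∀ i, ∑ e, A i e * g e = 0 := fun i => congrFun (LinearMap.mem_ker.mp hg) i
  let h : V → V → ℝ := fun u v => ∑ e : B, if e.1 = (u, v) then g e else 0
  have hout : ∀ u, ∑ w, h u w = ∑ e : B, if e.1.1 = u then g e else 0 := fun u => by
    rw [sum_comm]
    refine sum_congr rfl fun e _ => ?_
    simp only [Prod.ext_iff]
    by_cases he : e.1.1 = u <;> simp [he]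
  have hinn : ∀ v, ∑ u, h u v = ∑ e : B, if e.1.2 = v then g e else 0 := fun v => by
    rw [sum_comm]
    refine sum_congr rfl fun e _ => ?_
    simp only [Prod.ext_iff]
    by_cases he : e.1.2 = v <;> simp [he]
  have hout0 : ∀ u, ∑ w, h u w = 0 := fun u => by
    rw [hout]
    by_cases hu : u ∈ W
    · simpa [A] using hgA (.inl ⟨u, hu⟩)
    · refine sum_eq_zero fun e _ => if_neg fun he => hu ?_
      exact he ▸ mem_image_of_mem _ e.2
  have hin0 : ∀ v, v ≠ p₀.2 → ∑ u, h u v = 0 := fun v hv => by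
    rw [hinn]
    by_cases hu : v ∈ M
    · simpa [A] using hgA (.inr ⟨v, mem_erase.mpr ⟨hv, hu⟩⟩)
    · refine sum_eq_zero fun e _ => if_neg fun he => hu ?_
      exact he ▸ mem_image_of_mem _ e.2
  refine ⟨h, ?_, fun u v huv => ?_, hout0, fun v => ?_⟩
  · by_contra! hh
    apply hg0
    funext e
    have hsingle : h e.1.1 e.1.2 = g e := by
      simp only [h]
      rw [Fintype.sum_eq_single e fun e' he' => if_neg fun he => he' (Subtype.ext he)]
      exact if_pos rfl
    exact hsingle.symm.trans (hh _ _)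
  · refine sum_eq_zero fun e _ => if_neg fun he => huv ?_
    exact he ▸ e.2
  · by_cases hv : v = p₀.2
    · have : ∑ v, ∑ u, h u v = 0 := by
        rw [sum_comm]
        exact sum_eq_zero fun u _ => hout0 u
      rw [Fintype.sum_eq_single p₀.2 hin0] at this
      rw [hv, this]
    · exact hin0 v hv

/-- In a reduced flow some vertex sending flow only into `D` either has a unique target, or is
the unique source of one of its targets. -/
lemma ReducedFlow.exists_leaf {D : Finset V} {d : V → ℝ} {c : ℝ} {F : V → V → ℝ}
    (hd : ∀ v, 0 ≤ d v) (hF : ReducedFlow D d c F) (hin : ∃ t ∈ D, ∃ u, F u t ≠ 0) :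
    ∃ w, ∃ t ∈ D, F w t ≠ 0 ∧ (∀ x, F w x ≠ 0 → x ∈ D) ∧
      ((∀ x, F w x ≠ 0 → x = t) ∨ ∀ u, F u t ≠ 0 → u = w) := by
  classical
  obtain ⟨M, hMD, ⟨t, ht⟩, hM, hclosed⟩ := hF.exists_extremal hd hin
  by_contra! hno
  obtain ⟨u, hut⟩ := hM t ht
  let B : Finset (V × V) := univ.filter fun p => p.2 ∈ M ∧ F p.1 p.2 ≠ 0
  have hB : ∀ p, p ∈ B ↔ p.2 ∈ M ∧ F p.1 p.2 ≠ 0 := fun p => by simp [B]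
  obtain ⟨h, ⟨x, y, hxy⟩, hs, hout, hinn⟩ := exists_balanced_of_two_le_degree B
    ⟨(u, t), (hB _).mpr ⟨ht, hut⟩⟩
    (fun p hp => by
      obtain ⟨hp1, hp2⟩ := (hB p).mp hp
      obtain ⟨⟨z, hz, hzne⟩, -⟩ := hno p.1 p.2 (hMD hp1) hp2
        fun x hx => hMD (hclosed _ hp1 _ hp2 _ hx)
      exact ⟨(p.1, z), (hB _).mpr ⟨hclosed _ hp1 _ hp2 _ hz, hz⟩, rfl,
        fun he => hzne (congrArg Prod.snd he)⟩)
    (fun p hp => by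
      obtain ⟨hp1, hp2⟩ := (hB p).mp hp
      obtain ⟨-, z, hz, hzne⟩ := hno p.1 p.2 (hMD hp1) hp2
        fun x hx => hMD (hclosed _ hp1 _ hp2 _ hx)
      exact ⟨(z, p.2), (hB _).mpr ⟨hp1, hz⟩, rfl, fun he => hzne (congrArg Prod.fst he)⟩)
  exact hxy (hF.eq_zero (fun a b hab => hs a b fun hmem => ((hB _).mp hmem).2 hab)
    (fun a => (hout a).le) (fun a => by rw [hout, hinn, sub_zero]) x y)

lemma sum_ite_eq_sub_add (f : V → ℝ) (w : V) (r : ℝ) :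
    ∑ u, (if u = w then r else f u) = ∑ u, f u - f w + r := by
  rw [← add_sum_erase _ _ (mem_univ w), ← add_sum_erase univ f (mem_univ w), if_pos rfl,
    sum_congr rfl fun u hu => if_neg (ne_of_mem_erase hu)]
  ring

/-- A leaky flow can be rerouted so that some vertex sends all its flow to one vertex of `D`,
without losing total inflow into `D` and without overloading any vertex of `D`. -/
lemma LeakyFlow.exists_pivot {D : Finset V} {d : V → ℝ} {c : ℝ} {F : V → V → ℝ}
    (hd : ∀ v, 0 ≤ d v) (hF : LeakyFlow D d c F) (hin : ∃ t ∈ D, ∃ u, F u t ≠ 0) :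
    ∃ G, LeakyFlow D d c G ∧ (∀ u v, F u v = 0 → G u v = 0) ∧
      ∑ s ∈ D, ∑ u, G u s = ∑ s ∈ D, ∑ u, F u s ∧
      (∀ s ∈ D, ∑ u, G u s ≤ ∑ u, F u s ∨ ∑ u, G u s ≤ c) ∧
      ∃ w, ∃ t ∈ D, F w t ≠ 0 ∧ ∀ x, x ≠ t → G w x = 0 := by
  obtain ⟨K, hK, hKs, hKin⟩ := hF.exists_reduced
  obtain ⟨w, t, ht, hwt, hwD, hw⟩ := hK.exists_leaf hd (by
    obtain ⟨t, ht, u, hu⟩ := hin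
    refine ⟨t, ht, ?_⟩
    by_contra! h0
    have := hKin t ht
    simp only [h0, sum_const_zero] at this
    exact hu ((sum_eq_zero_iff_of_nonneg fun u _ => hF.1 u t).mp this.symm u (mem_univ u)))
  have hFwt : F w t ≠ 0 := fun h => hwt (hKs w t h)
  obtain ⟨hK0, hKD, hKc, hKl⟩ := hK.1
  rcases hw with hw | hw
  · refine ⟨K, hK.1, hKs, sum_congr rfl hKin, fun s hs => .inl (hKin s hs).le, w, t, ht, hFwt,
      fun x hx => ?_⟩
    by_contra h
    exact hx (hw x h)
  have hwnD : w ∉ D := fun h => hwt (hKD w h t)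
  set o := ∑ x, K w x with ho
  have ho0 : 0 ≤ o := sum_nonneg fun x _ => hK0 w x
  let G : V → V → ℝ := fun u x => if u = w then (if x = t then o else 0) else K u x
  have hcol : ∀ x, ∑ u, G u x = ∑ u, K u x - K w x + if x = t then o else 0 := fun x =>
    sum_ite_eq_sub_add (fun u => K u x) w _
  have hrow : ∀ u, ∑ x, G u x = ∑ x, K u x := fun u => by
    by_cases hu : u = w
    · simp [G, hu, ho]
    · simp [G, hu]
  refine ⟨G, ⟨fun u v => ?_, fun u hu v => ?_, fun u => ?_, fun u hu => ?_⟩, fun u v huv => ?_, ?_,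
    fun s hs => ?_, w, t, ht, hFwt, fun x hx => ?_⟩
  · simp only [G]
    split_ifs <;> simp [hK0, ho0]
  · have : u ≠ w := fun h => hwnD (h ▸ hu)
    simp [G, this, hKD u hu]
  · exact (hrow u).trans_le (hKc u)
  · have hut : u ≠ t := fun h => hu (h ▸ ht)
    have h0 : K w u = 0 := by
      by_contra h
      exact hu (hwD u h)
    rw [hrow, hcol, h0, if_neg hut]
    linarith [hKl u hu]
  · simp only [G]
    split_ifs with h1 h2
    · subst h1 h2
      exact absurd huv hFwt
    · rfl
    · exact hKs u v huv
  · have h0 : ∑ s ∈ D, K w s = o := sum_subset (subset_univ D) fun x _ hx => by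
      by_contra h
      exact hx (hwD x h)
    rw [← sum_congr rfl hKin, sum_congr rfl fun x _ => hcol x, sum_add_distrib, sum_sub_distrib,
      h0, sum_ite_eq' D t, if_pos ht]
    ring
  · rw [hcol]
    by_cases hst : s = t
    · right
      have : ∑ u, K u t = K w t := Fintype.sum_eq_single w fun u hu => by
        by_contra h
        exact hu (hw u h)
      rw [hst, this, if_pos rfl]
      linarith [hKc w]
    · left
      rw [if_neg hst, hKin s hs]
      linarith [hK0 w s]
  · simp [G, hx]

/-- `D` is partitioned into trees, oriented along `nxt` towards roots in `S`. -/
def IsForest (E : V → V → Prop) (S : Set V) (D : Finset V) (nxt : V → V) (rk : V → ℕ)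
    (root : V → V) : Prop :=
  ∀ v ∈ D, (v ∈ S ∧ root v = v) ∨
    (v ∉ S ∧ E v (nxt v) ∧ nxt v ∈ D ∧ rk (nxt v) < rk v ∧ root (nxt v) = root v)

/-- The total demand of the tree with root `t`. -/
def treeDemand (D : Finset V) (root : V → V) (d : V → ℝ) (t : V) : ℝ :=
  ∑ v ∈ D, if root v = t then d v else 0

set_option linter.unusedSectionVars false in
lemma treeDemand_mono {D D' : Finset V} {root root' : V → V} {d : V → ℝ} (hd : ∀ v, 0 ≤ d v)
    (hD : D ⊆ D') (hr : ∀ v ∈ D, root' v = root v) (t : V) :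
    treeDemand D root d t ≤ treeDemand D' root' d t := by
  unfold treeDemand
  rw [sum_congr rfl fun v hv => by rw [← hr v hv]]
  exact sum_le_sum_of_subset_of_nonneg hD fun v _ _ => by split_ifs <;> simp [hd]

set_option linter.unusedSectionVars false in
lemma treeDemand_insert {D : Finset V} {w : V} (hw : w ∉ D) (root : V → V) (d : V → ℝ) (t s : V) :
    treeDemand (insert w D) (Function.update root w t) d s =
      (if t = s then d w else 0) + treeDemand D root d s := by
  unfold treeDemand
  rw [sum_insert hw, Function.update_self]
  congr 1
  refine sum_congr rfl fun v hv => ?_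
  have hne : v ≠ w := fun h => hw (h ▸ hv)
  rw [Function.update_of_ne hne]

set_option linter.unusedSectionVars false in
lemma IsForest.insert {E : V → V → Prop} {S : Set V} {D : Finset V} {nxt : V → V} {rk : V → ℕ}
    {root : V → V} (h : IsForest E S D nxt rk root) {w y : V} (hwD : w ∉ D) (hwS : w ∉ S)
    (hy : y ∈ D) (hE : E w y) :
    IsForest E S (insert w D) (Function.update nxt w y) (Function.update rk w (rk y + 1))
      (Function.update root w (root y)) := by
  have hne : ∀ v ∈ D, v ≠ w := fun v hv h => hwD (h ▸ hv)
  intro v hv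
  rcases mem_insert.mp hv with rfl | hv
  · right
    simp [hwS, hE, hy, hne y hy]
  · simp only [Function.update_of_ne (hne v hv)]
    rcases h v hv with h1 | ⟨h1, h2, h3, h4, h5⟩
    · exact .inl h1
    · right
      simp only [Function.update_of_ne (hne _ h3)]
      exact ⟨h1, h2, mem_insert_of_mem h3, h4, h5⟩

/-- A vertex sending all its flow to `t ∈ D` can be absorbed into `t`, keeping loads. -/
lemma LeakyFlow.exists_contract {D : Finset V} {d : V → ℝ} {c : ℝ} {G : V → V → ℝ} (hc : 0 ≤ c)
    (hd : ∀ v, 0 ≤ d v) (hG : LeakyFlow D d c G) {w t : V} (hw : w ∉ D) (ht : t ∈ D)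
    (hwt : ∀ x, x ≠ t → G w x = 0) :
    ∃ H e, LeakyFlow (insert w D) d c H ∧ 0 ≤ e ∧ e ≤ d w ∧
      e + ∑ u, H u t = ∑ u, G u t ∧ (∀ s ∈ D, s ≠ t → ∑ u, H u s = ∑ u, G u s) ∧
      ∀ u x, H u x ≠ 0 → u ≠ w ∧ x ≠ w ∧ (G u x ≠ 0 ∨ (x = t ∧ G u w ≠ 0)) := by
  obtain ⟨hG0, hGD, hGc, hGl⟩ := hG
  have hne : t ≠ w := fun h => hw (h ▸ ht)
  have hww : G w w = 0 := hwt w hne.symm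
  have ho : ∑ x, G w x = G w t := Fintype.sum_eq_single t hwt
  obtain ⟨e, l, he0, hed, hl0, hl1, hel⟩ : ∃ e l : ℝ, 0 ≤ e ∧ e ≤ d w ∧ 0 ≤ l ∧ l ≤ 1 ∧
      l * ∑ u, G u w + e = G w t := by
    have h1 := hGl w hw
    rw [ho] at h1
    rcases le_or_gt (G w t) (d w) with h | h
    · exact ⟨G w t, 0, hG0 w t, h, le_rfl, zero_le_one, by ring⟩
    · have hpos : 0 < ∑ u, G u w := by linarith
      refine ⟨d w, (G w t - d w) / ∑ u, G u w, hd w, le_rfl, ?_, ?_, ?_⟩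
      · exact div_nonneg (by linarith) hpos.le
      · rw [div_le_one hpos]
        linarith
      · rw [div_mul_cancel₀ _ hpos.ne']
        ring
  let K : V → V → ℝ := fun u x => if x = w then 0 else G u x + if x = t then l * G u w else 0
  let H : V → V → ℝ := fun u x => if u = w then 0 else K u x
  have hcol : ∀ x, ∑ u, H u x = ∑ u, K u x - K w x := fun x => by
    simp only [H, sum_ite_eq_sub_add (fun u => K u x) w 0, add_zero]
  have hcolt : ∑ u, H u t = ∑ u, G u t - G w t + l * ∑ u, G u w := by
    rw [hcol]
    simp only [K, if_neg hne, if_true, hww, sum_add_distrib, mul_sum]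
    ring
  have hcolx : ∀ x, x ≠ w → x ≠ t → ∑ u, H u x = ∑ u, G u x := fun x hx hxt => by
    rw [hcol]
    simp [K, hx, hxt, hwt]
  have hrow : ∀ u, u ≠ w → ∑ x, H u x ≤ ∑ x, G u x := fun u hu => by
    have : ∑ x, H u x = ∑ x, G u x - G u w + l * G u w := by
      simp only [H, K, if_neg hu]
      rw [sum_ite_eq_sub_add (fun x => G u x + if x = t then l * G u w else 0) w 0,
        sum_add_distrib, sum_ite_eq' univ t, if_pos (mem_univ t), if_neg hne.symm]
      ring
    rw [this]
    nlinarith [hG0 u w]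
  refine ⟨H, e, ⟨fun u v => ?_, fun u hu v => ?_, fun u => ?_, fun u hu => ?_⟩, he0, hed, ?_,
    fun s hs hst => hcolx s (fun h => hw (h ▸ hs)) hst, fun u x hux => ?_⟩
  · have := mul_nonneg hl0 (hG0 u w)
    have := hG0 u v
    simp only [H, K]
    split_ifs <;> positivity
  · by_cases huw : u = w
    · simp [H, huw]
    · have := hGD u (mem_of_mem_insert_of_ne hu huw)
      simp [H, K, this]
  · by_cases huw : u = w
    · simpa [H, huw] using hc
    · exact (hrow u huw).trans (hGc u)
  · rw [mem_insert, not_or] at hu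
    rw [hcolx u hu.1 fun h => hu.2 (h ▸ ht)]
    exact (hrow u hu.1).trans (hGl u hu.2)
  · rw [hcolt]
    linarith
  · simp only [H, K] at hux
    split_ifs at hux with h1 h2 h3
    · exact absurd rfl hux
    · exact absurd rfl hux
    · refine ⟨h1, h2, ?_⟩
      by_contra! h
      exact hux (by rw [h.1, h.2 h3]; ring)
    · exact ⟨h1, h2, .inl (by simpa using hux)⟩

lemma exists_forest_extension {E : V → V → Prop} {S : Set V} {d : V → ℝ} {c : ℝ} (hc : 0 ≤ c)
    (hd : ∀ v, 0 ≤ d v) (n : ℕ) (D : Finset V) (nxt : V → V) (rk : V → ℕ) (root : V → V)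
    (T : Finset V) (a : V → ℝ) (F : V → V → ℝ) (hn : #Dᶜ + #T = n) (hSD : ∀ v ∈ S, v ∈ D)
    (hTD : T ⊆ D) (hfor : IsForest E S D nxt rk root) (hF : LeakyFlow D d c F)
    (hsupp : ∀ u v, F u v ≠ 0 → (v ∉ D ∧ E u v) ∨ (v ∈ T ∧ ∃ w ∈ D, root w = v ∧ E u w))
    (ha : ∀ t ∈ T, 0 ≤ a t ∧ a t ≤ treeDemand D root d t ∧ a t + ∑ u, F u t ≤ 3 * c / 2) :
    ∃ D' nxt' rk' root', D ⊆ D' ∧ (∀ v ∈ D, root' v = root v) ∧ IsForest E S D' nxt' rk' root' ∧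
      (∑ t ∈ T, (a t + ∑ u, F u t)) / 3 ≤ ∑ t ∈ T, min c (treeDemand D' root' d t) := by
  induction n using Nat.strong_induction_on generalizing D nxt rk root T a F with
  | _ n ih =>
  by_cases hfull : ∃ t ∈ T, c / 2 ≤ a t
  · -- the tree at `t` already carries enough demand: freeze it
    obtain ⟨t, ht, hat⟩ := hfull
    have htD := hTD ht
    have hcol : ∀ x, x ≠ t → ∑ u, (if x = t then 0 else F u x) = ∑ u, F u x := fun x hx => by
      simp [hx]
    have hrow : ∀ u, ∑ x, (if x = t then 0 else F u x) ≤ ∑ x, F u x := fun u =>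
      sum_le_sum fun x _ => by split_ifs <;> simp [hF.1 u]
    have hcard : #(T.erase t) < #T := card_erase_lt_of_mem ht
    obtain ⟨D', nxt', rk', root', h1, h2, h3, h4⟩ := ih (#Dᶜ + #(T.erase t)) (by omega) D nxt rk
      root (T.erase t) a (fun u x => if x = t then 0 else F u x) rfl hSD
      ((erase_subset _ _).trans hTD) hfor
      ⟨fun u v => by dsimp only; split_ifs <;> simp [hF.1 u v],
        fun u hu v => by simp [hF.2.1 u hu v], fun u => (hrow u).trans (hF.2.2.1 u),
        fun u hu => by
          rw [hcol u fun h => hu (h ▸ htD)]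
          exact (hrow u).trans (hF.2.2.2 u hu)⟩
      (fun u v huv => by
        split_ifs at huv with hv
        · exact absurd rfl huv
        · exact (hsupp u v huv).imp id fun h => ⟨mem_erase.mpr ⟨hv, h.1⟩, h.2⟩)
      (fun s hs => by
        rw [hcol s (ne_of_mem_erase hs)]
        exact ha s (mem_of_mem_erase hs))
    refine ⟨D', nxt', rk', root', h1, h2, h3, ?_⟩
    rw [sum_congr rfl fun s hs => by rw [hcol s (ne_of_mem_erase hs)]] at h4
    rw [← add_sum_erase T _ ht, ← add_sum_erase T _ ht]
    obtain ⟨-, hat', hload⟩ := ha t ht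
    have hmono := treeDemand_mono hd h1 h2 t
    have : c / 2 ≤ min c (treeDemand D' root' d t) := le_min (by linarith) (by linarith)
    linarith
  · push Not at hfull
    by_cases hin : ∃ t ∈ D, ∃ u, F u t ≠ 0
    · obtain ⟨G, hG, hGs, hGsum, hGle, w, t, htD, hwt, hw⟩ := hF.exists_pivot hd hin
      have hwD : w ∉ D := fun h => hwt (hF.2.1 w h t)
      obtain ⟨htT, y, hyD, rfl, hwy⟩ : t ∈ T ∧ ∃ y ∈ D, root y = t ∧ E w y :=
        (hsupp w t hwt).resolve_left fun h => h.1 htD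
      obtain ⟨H, e, hH, he0, hed, hHt, hHs, hHsupp⟩ := hG.exists_contract hc hd hwD htD hw
      have hcard : #(insert w D)ᶜ < #Dᶜ :=
        card_lt_card (compl_ssubset_compl.mpr (ssubset_insert hwD))
      have hload : ∀ s ∈ T, (if s = root y then a s + e else a s) + ∑ u, H u s =
          a s + ∑ u, G u s := fun s hs => by
        split_ifs with h
        · rw [h, ← hHt]
          ring
        · rw [hHs s (hTD hs) h]
      obtain ⟨D', nxt', rk', root', h1, h2, h3, h4⟩ := ih (#(insert w D)ᶜ + #T) (by omega)
        (insert w D) (Function.update nxt w y) (Function.update rk w (rk y + 1))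
        (Function.update root w (root y)) T (fun s => if s = root y then a s + e else a s) H rfl
        (fun v hv => mem_insert_of_mem (hSD v hv)) (hTD.trans (subset_insert _ _))
        (hfor.insert hwD (fun h => hwD (hSD w h)) hyD hwy) hH
        (fun u v huv => by
          obtain ⟨-, hvw, hGu⟩ := hHsupp u v huv
          rcases hGu with hGu | ⟨rfl, hGu⟩
          · rcases hsupp u v (fun h => hGu (hGs u v h)) with ⟨h5, h6⟩ | ⟨h5, z, h6, h7, h8⟩
            · exact .inl ⟨by simp [h5, hvw], h6⟩
            · refine .inr ⟨h5, z, mem_insert_of_mem h6, ?_, h8⟩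
              have : z ≠ w := fun h => hwD (h ▸ h6)
              rw [Function.update_of_ne this, h7]
          · refine .inr ⟨htT, w, mem_insert_self _ _, Function.update_self .., ?_⟩
            rcases hsupp u w (fun h => hGu (hGs u w h)) with ⟨-, h6⟩ | ⟨h5, -⟩
            · exact h6
            · exact absurd (hTD h5) hwD)
        (fun s hs => by
          obtain ⟨h5, h6, h7⟩ := ha s hs
          rw [hload s hs, treeDemand_insert hwD]
          refine ⟨?_, ?_, ?_⟩
          · split_ifs <;> linarith
          · by_cases hst : s = root y
            · subst hst
              simp only [if_true]
              linarith
            · rw [if_neg hst, if_neg (Ne.symm hst)]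
              linarith
          · have := hfull s hs
            rcases hGle s (hTD hs) with h | h <;> linarith)
      refine ⟨D', nxt', rk', root', (subset_insert _ _).trans h1, fun v hv => ?_, h3, ?_⟩
      · have : v ≠ w := fun h => hwD (h ▸ hv)
        rw [h2 v (mem_insert_of_mem hv), Function.update_of_ne this]
      · rw [sum_congr rfl hload] at h4
        have hzero : ∀ s ∈ D, s ∉ T → ∀ u, F u s = 0 := fun s hs hsT u => by
          by_contra h
          rcases hsupp u s h with h5 | h5
          · exact h5.1 hs
          · exact hsT h5.1
        have e1 : ∑ s ∈ T, ∑ u, F u s = ∑ s ∈ D, ∑ u, F u s :=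
          sum_subset hTD fun s hs hsT => sum_eq_zero fun u _ => hzero s hs hsT u
        have e2 : ∑ s ∈ T, ∑ u, G u s = ∑ s ∈ D, ∑ u, G u s :=
          sum_subset hTD fun s hs hsT => sum_eq_zero fun u _ => hGs u s (hzero s hs hsT u)
        rw [sum_add_distrib, e2, hGsum, ← e1, ← sum_add_distrib] at h4
        exact h4
    · push Not at hin
      refine ⟨D, nxt, rk, root, Subset.rfl, fun _ _ => rfl, hfor, ?_⟩
      rw [sum_div]
      refine sum_le_sum fun t ht => ?_
      obtain ⟨h1, h2, h3⟩ := ha t ht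
      simp only [hin t (hTD ht), sum_const_zero, add_zero] at h3 ⊢
      exact le_min (by linarith) (by linarith)

/-- Demands on a forest whose trees have total demand at most `c` are routed by a confluent
flow of congestion at most `c`. -/
lemma IsForest.exists_confluent {E : V → V → Prop} {S : Set V} {D : Finset V} {nxt : V → V}
    {rk : V → ℕ} {root : V → V} (h : IsForest E S D nxt rk root)
    {d : V → ℝ} {c : ℝ} (hd : ∀ v, 0 ≤ d v) (hdD : ∀ v ∉ D, d v = 0)
    (hc : ∀ t, treeDemand D root d t ≤ c) :
    ∃ f : V → V → ℝ, IsFlow E S d f ∧ IsConfluent f ∧ ∀ v, ∑ u, f u v + d v ≤ c := by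
  classical
  let P : V → V → Prop := fun u w => u ∈ D ∧ u ∉ S ∧ nxt u = w
  have hP : ∀ u w, P u w → E u w ∧ w ∈ D ∧ rk w < rk u ∧ root w = root u := by
    rintro u w ⟨hu, hS, rfl⟩
    rcases h u hu with h1 | ⟨-, h2⟩
    · exact absurd h1.1 hS
    · exact h2
  have hPuniq : Relator.RightUnique P := fun u v w h1 h2 => h1.2.2.symm.trans h2.2.2
  let R := Relation.ReflTransGen P
  have hR : ∀ x u, R x u → rk u ≤ rk x ∧ root u = root x := by
    intro x u hxu
    induction hxu with
    | refl => exact ⟨le_rfl, rfl⟩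
    | tail _ h2 ih =>
      obtain ⟨-, -, h3, h4⟩ := hP _ _ h2
      exact ⟨h3.le.trans ih.1, h4.trans ih.2⟩
  have huniq : ∀ x u₁ u₂ v, R x u₁ → P u₁ v → R x u₂ → P u₂ v → u₁ = u₂ := by
    have aux : ∀ u₁ u₂ v, R u₁ u₂ → P u₁ v → P u₂ v → u₁ = u₂ := by
      intro u₁ u₂ v h12 h1 h2
      rcases Relation.ReflTransGen.cases_head h12 with h3 | ⟨z, hz, hz2⟩
      · exact h3
      · obtain rfl := hPuniq hz h1
        have := (hR _ _ hz2).1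
        have := (hP _ _ h2).2.2.1
        omega
    intro x u₁ u₂ v h1 p1 h2 p2
    rcases Relation.ReflTransGen.total_of_right_unique hPuniq h1 h2 with h3 | h3
    · exact aux _ _ _ h3 p1 p2
    · exact (aux _ _ _ h3 p2 p1).symm
  let L : V → ℝ := fun v => ∑ x, if R x v then d x else 0
  have hL0 : ∀ v, 0 ≤ L v := fun v => sum_nonneg fun x _ => by split_ifs <;> simp [hd]
  have hLc : ∀ v, L v ≤ c := fun v => by
    refine le_trans ?_ (hc (root v))
    simp only [L, treeDemand]
    rw [← sum_subset (subset_univ D) fun x _ hx => by simp [hdD x hx]]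
    refine sum_le_sum fun x _ => ?_
    split_ifs with h1 h2 h2
    · rfl
    · exact absurd (hR x v h1).2.symm h2
    · exact hd x
    · rfl
  let f : V → V → ℝ := fun u w => if P u w then L u else 0
  have hin : ∀ v, ∑ u, f u v + d v = L v := fun v => by
    have e1 : ∑ u, f u v = ∑ x, ∑ u, if P u v ∧ R x u then d x else 0 := by
      rw [sum_comm]
      refine sum_congr rfl fun u _ => ?_
      by_cases hu : P u v <;> simp [f, L, hu]
    have e2 : d v = ∑ x, if x = v then d x else 0 := by simp
    rw [e1, e2, ← sum_add_distrib]
    refine sum_congr rfl fun x _ => ?_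
    by_cases hxv : x = v
    · subst hxv
      have h0 : ∀ u, ¬ (P u x ∧ R x u) := fun u hu => by
        have := (hR _ _ hu.2).1
        have := (hP _ _ hu.1).2.2.1
        omega
      have : R x x := .refl
      simp [h0, this]
    · by_cases hR' : R x v
      · obtain h3 | ⟨u, hu1, hu2⟩ := Relation.ReflTransGen.cases_tail hR'
        · exact absurd h3.symm hxv
        · rw [Fintype.sum_eq_single u fun u' hu' =>
            if_neg fun h4 => hu' (huniq _ _ _ _ h4.2 h4.1 hu1 hu2)]
          rw [if_pos ⟨hu2, hu1⟩, if_neg hxv, if_pos hR', add_zero]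
      · have h0 : ∀ u, ¬ (P u v ∧ R x u) := fun u hu => hR' (hu.2.tail hu.1)
        simp [h0, hxv, hR']
  have hfP : ∀ u w, 0 < f u w → P u w := fun u w hf => by
    by_contra hP'
    simp [f, hP'] at hf
  refine ⟨f, ⟨fun u v => ?_, fun u v huv => if_neg fun hp => huv (hP u v hp).1, fun v hv => ?_⟩,
    ⟨?_, fun v w₁ w₂ h1 h2 => hPuniq (hfP _ _ h1) (hfP _ _ h2)⟩, fun v => (hin v).trans_le (hLc v)⟩
  · simp only [f]
    split_ifs <;> simp [hL0]
  · by_cases hvD : v ∈ D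
    · have : ∑ w, f v w = L v := by simp [f, P, hvD, hv]
      linarith [hin v]
    · have e1 : ∑ w, f v w = 0 := sum_eq_zero fun w _ => if_neg fun hp => hvD hp.1
      have e2 : ∑ u, f u v = 0 := sum_eq_zero fun u _ => if_neg fun hp => hvD (hP _ _ hp).2.1
      rw [e1, e2, hdD v hvD, sub_zero]
  · rintro ⟨n, hn, p, -, hp⟩
    have : Nonempty (Fin n) := ⟨⟨0, hn⟩⟩
    obtain ⟨i, hi⟩ := Finite.exists_min fun i => rk (p i)
    exact absurd (hP _ _ (hfP _ _ (hp i))).2.2.1 (not_lt.mpr (hi _))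

/-- Chen et al.: if there is a flow with demand `d` and congestion at most `c`, then
there is a confluent flow with congestion at most `c` and demand function `d'` with
`d' ≤ d` pointwise and total demand `d'(V) ≥ d(V)/3`. -/
theorem exists_confluent_flow (E : V → V → Prop) (S : Set V)
    (hS : ∀ v ∈ S, ∀ w, ¬ E v w)
    (d : V → ℝ) (hd : ∀ v, 0 ≤ d v) (c : ℝ)
    (f : V → V → ℝ) (hf : IsFlow E S d f)
    (hcong : ∀ v, (∑ u, f u v) + d v ≤ c) :
    ∃ (f' : V → V → ℝ) (d' : V → ℝ),
      (∀ v, 0 ≤ d' v) ∧ (∀ v, d' v ≤ d v) ∧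
      IsFlow E S d' f' ∧ IsConfluent f' ∧
      (∀ v, (∑ u, f' u v) + d' v ≤ c) ∧
      (∑ v, d v) / 3 ≤ ∑ v, d' v := by
  classical
  obtain ⟨hf0, hfE, hfc⟩ := hf
  rcases isEmpty_or_nonempty V with hV | ⟨⟨v₀⟩⟩
  · exact ⟨f, d, hd, fun _ => le_rfl, ⟨hf0, hfE, hfc⟩,
      ⟨fun ⟨n, hn, p, _⟩ => hV.elim (p ⟨0, hn⟩), fun v => hV.elim v⟩, hcong, by simp⟩
  have hc : 0 ≤ c := (add_nonneg (sum_nonneg fun u _ => hf0 u v₀) (hd v₀)).trans (hcong v₀)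
  let D : Finset V := univ.filter (· ∈ S)
  have hD : ∀ v, v ∈ D ↔ v ∈ S := fun v => by simp [D]
  have hfS : ∀ v ∈ S, ∀ w, f v w = 0 := fun v hv w => hfE v w (hS v hv w)
  have hout : ∀ v ∉ S, ∑ w, f v w = ∑ u, f u v + d v := fun v hv => by linarith [hfc v hv]
  have htree : ∀ t ∈ D, treeDemand D id d t = d t := fun t ht => by simp [treeDemand, ht]
  obtain ⟨D', nxt, rk, root, -, -, hfor, hval⟩ := exists_forest_extension (E := E) (S := S)
    hc hd _ D id (fun _ => 0) id D d f rfl (fun v hv => (hD v).mpr hv) Subset.rfl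
    (fun v hv => .inl ⟨(hD v).mp hv, rfl⟩)
    ⟨hf0, fun u hu => hfS u ((hD u).mp hu), fun u => by
      by_cases hu : u ∈ S
      · simpa [hfS u hu] using hc
      · rw [hout u hu]
        exact hcong u, fun u hu => (hout u fun h => hu ((hD u).mpr h)).le⟩
    (fun u v huv => by
      have hE : E u v := by
        by_contra h
        exact huv (hfE u v h)
      by_cases hv : v ∈ D
      · exact .inr ⟨hv, v, hv, rfl, hE⟩
      · exact .inl ⟨hv, hE⟩)
    (fun t ht => ⟨hd t, (htree t ht).ge, by linarith [hcong t]⟩)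
  have hsum : ∑ t ∈ D, (d t + ∑ u, f u t) = ∑ v, d v := by
    have h1 : ∑ v, ∑ w, f v w = ∑ v, ∑ u, f u v := sum_comm
    have h2 : ∑ v, (∑ u, f u v + d v - ∑ w, f v w) = ∑ t ∈ D, (d t + ∑ u, f u t) := by
      rw [← sum_subset (subset_univ D) fun v _ hv => by
        rw [hout v fun h => hv ((hD v).mpr h), sub_self]]
      refine sum_congr rfl fun t ht => ?_
      rw [sum_eq_zero fun w _ => hfS t ((hD t).mp ht) w]
      ring
    rw [← h2, sum_sub_distrib, sum_add_distrib]
    linarith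
  let W := treeDemand D' root d
  have hW0 : ∀ t, 0 ≤ W t := fun t => sum_nonneg fun v _ => by split_ifs <;> simp [hd]
  obtain ⟨θ, hθ⟩ : ∃ θ : V → ℝ, ∀ t, 0 ≤ θ t ∧ θ t ≤ 1 ∧ θ t * W t = min c (W t) := by
    refine ⟨fun t => if W t ≤ c then 1 else c / W t, fun t => ?_⟩
    dsimp only
    split_ifs with h
    · simp [h]
    · have hpos : 0 < W t := by linarith
      refine ⟨div_nonneg hc hpos.le, (div_le_one hpos).mpr (by linarith), ?_⟩
      rw [div_mul_cancel₀ _ hpos.ne', min_eq_left (by linarith)]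
  let d' : V → ℝ := fun v => if v ∈ D' then θ (root v) * d v else 0
  have hd'0 : ∀ v, 0 ≤ d' v := fun v => by
    simp only [d']
    split_ifs
    · exact mul_nonneg (hθ _).1 (hd v)
    · rfl
  have hW' : ∀ t, treeDemand D' root d' t = min c (W t) := fun t => by
    rw [← (hθ t).2.2]
    simp only [W, treeDemand, mul_sum]
    refine sum_congr rfl fun v hv => ?_
    by_cases hvt : root v = t <;> simp [d', hv, hvt]
  obtain ⟨f', h1, h2, h3⟩ := hfor.exists_confluent hd'0
    (fun v hv => if_neg hv) (fun t => (hW' t).trans_le (min_le_left _ _))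
  refine ⟨f', d', hd'0, fun v => ?_, h1, h2, h3, ?_⟩
  · simp only [d']
    split_ifs
    · exact mul_le_of_le_one_left (hd v) (hθ _).2.1
    · exact hd v
  · rw [hsum] at hval
    refine hval.trans ?_
    have : ∑ v, d' v = ∑ t, treeDemand D' root d' t := by
      simp only [treeDemand]
      rw [sum_comm, ← sum_subset (subset_univ D') fun v _ hv => if_neg hv]
      exact sum_congr rfl fun v _ => by simp [d']
    rw [this, sum_congr rfl fun t _ => hW' t]
    exact sum_le_sum_of_subset_of_nonneg (subset_univ D) fun t _ _ => le_min hc (hW0 t)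
end
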